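/- arXiv:0911.5546 — 3 statements merged into one kernel-verified Lean document; each statement's English description precedes it below -/
import Mathlib

section
/- Let (X_n) be a sequence of n×n unitarily invariant random matrices with noncommutative entries which has asymptotically vanishing commutators up to degree m₀. Assume that the limit K_{(V,π)} = lim_{n→∞} n^{|(V,π)|} κ_{(V,π)} exists and is finite for all partitioned permutations (V,π) of {1,…,m} for all m < m₀, and that the limit M_{p₁,…,p_l} = lim_{n→∞} n^{2l−2} k(tr X_n^{p₁},…,tr X_n^{p_l}) exists and is finite for all integers p₁,…,p_l ≥ 1 with p₁+⋯+p_l ≤ m₀. Then the limit K_{(V,π)} exists for every partitioned permutation (V,π) of {1,…,m} for all m ≤ m₀, and K_{(V,π)} depends only on the conjugacy class of (V,π). -/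
open scoped Classical BigOperators
open Filter

noncomputable section

namespace HOF

instance setoidFinite {α : Type*} [Finite α] : Finite (Setoid α) :=
  Finite.of_injective (fun V : Setoid α => V.r)
    (fun V W h => Setoid.ext fun a b => by rw [show V.r = W.r from h])

instance setoidFintype {α : Type*} [Finite α] : Fintype (Setoid α) := Fintype.ofFinite _

instance matrixMeasurableSpace {n : ℕ} : MeasurableSpace (Matrix (Fin n) (Fin n) ℂ) :=
  MeasurableSpace.pi

variable {A : Type*}

/-- Ordered product of the `a i` over the indices in `S`, in increasing order of indices. -/
def ordProd [Monoid A] {l : ℕ} (a : Fin l → A) (S : Set (Fin l)) : A :=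
  (((List.finRange l).filter (fun i => decide (i ∈ S))).map a).prod

/-- The moment functional `E_V` associated to a set partition `V` (encoded as a `Setoid`):
the product over the blocks of `V` of `E` applied to the ordered product over each block. -/
def momentV {R : Type*} [CommRing R] [Monoid A] {l : ℕ} (E : A → R)
    (V : Setoid (Fin l)) (a : Fin l → A) : R :=
  ∏ᶠ B ∈ Setoid.classes V, E (ordProd a B)

/-- `k` is the family of tensor cumulants associated to the expectation `E`:
for every partition `V`, `∑_{W ≤ V} k_W = E_V`. -/
def IsCumulant {R : Type*} [CommRing R] [Monoid A] (E : A → R)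
    (k : ∀ {l : ℕ}, Setoid (Fin l) → (Fin l → A) → R) : Prop :=
  ∀ (l : ℕ) (V : Setoid (Fin l)) (a : Fin l → A),
    ∑ W ∈ Finset.univ.filter (fun W : Setoid (Fin l) => W ≤ V), k W a = momentV E V a

/-- Number of blocks of a partition. -/
def numBlocks {l : ℕ} (V : Setoid (Fin l)) : ℕ := (Setoid.classes V).ncard

/-- The partition of cycles of a permutation. -/
def cycleSetoid {l : ℕ} (π : Equiv.Perm (Fin l)) : Setoid (Fin l) :=
  ⟨π.SameCycle, ⟨fun x => Equiv.Perm.SameCycle.refl π x, fun h => h.symm, fun h h' => h.trans h'⟩⟩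

/-- Number of cycles of a permutation. -/
def numCycles {l : ℕ} (π : Equiv.Perm (Fin l)) : ℕ := numBlocks (cycleSetoid π)

/-- `π ≤ V` : every cycle of `π` is contained in a block of `V`, i.e. `(V, π)` is a
partitioned permutation. -/
def permLePartition {l : ℕ} (π : Equiv.Perm (Fin l)) (V : Setoid (Fin l)) : Prop :=
  ∀ i, V.r i (π i)

/-- Length `|π| = l - #π` of a permutation. -/
def permLen {l : ℕ} (π : Equiv.Perm (Fin l)) : ℤ := (l : ℤ) - numCycles π

/-- Length `|(V,π)| = |π| + 2(#π - #V)` of a partitioned permutation. -/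
def ppLen {l : ℕ} (V : Setoid (Fin l)) (π : Equiv.Perm (Fin l)) : ℤ :=
  ((l : ℤ) - numCycles π) + 2 * ((numCycles π : ℤ) - numBlocks V)

/-- The order `(V,π) ≤ (W,σ)` on partitioned permutations, i.e.
`(V,π) ⬝ (0, π⁻¹σ) = (W,σ)` (with lengths adding up). -/
def ppLe {l : ℕ} (V : Setoid (Fin l)) (π : Equiv.Perm (Fin l))
    (W : Setoid (Fin l)) (σ : Equiv.Perm (Fin l)) : Prop :=
  V ⊔ cycleSetoid (π⁻¹ * σ) = W ∧ ppLen V π + permLen (π⁻¹ * σ) = ppLen W σ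

/-- `(V,π)` and `(W,τ)` are conjugate by the permutation `σ`. -/
def ppConjBy {l : ℕ} (σ : Equiv.Perm (Fin l)) (V : Setoid (Fin l)) (π : Equiv.Perm (Fin l))
    (W : Setoid (Fin l)) (τ : Equiv.Perm (Fin l)) : Prop :=
  τ = σ * π * σ⁻¹ ∧ ∀ a b, W.r a b ↔ V.r (σ⁻¹ a) (σ⁻¹ b)

/-- `(V,π)` and `(W,τ)` are conjugate partitioned permutations. -/
def ppConj {l : ℕ} (V : Setoid (Fin l)) (π : Equiv.Perm (Fin l))
    (W : Setoid (Fin l)) (τ : Equiv.Perm (Fin l)) : Prop :=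
  ∃ σ : Equiv.Perm (Fin l), ppConjBy σ V π W τ

/-- The `(i,j)` entry of `U X U⁻¹ = U X U*` for a unitary `U` (with complex entries) and a
matrix `X` with noncommutative entries. -/
def conjEntry [Ring A] [Algebra ℂ A] {n : ℕ} (U : Matrix (Fin n) (Fin n) ℂ)
    (X : Matrix (Fin n) (Fin n) A) (i j : Fin n) : A :=
  ∑ a : Fin n, ∑ b : Fin n, (U i a * star (U j b)) • X a b

/-- A random matrix with noncommutative entries is unitarily invariant if for every unitary `U`
the joint distribution (all joint moments under `E`) of the entries of `U X U⁻¹` coincides with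
that of the entries of `X`. -/
def UnitarilyInvariant [Ring A] [Algebra ℂ A] (E : A → ℂ) {n : ℕ}
    (X : Matrix (Fin n) (Fin n) A) : Prop :=
  ∀ U ∈ Matrix.unitaryGroup (Fin n) ℂ, ∀ (m : ℕ) (i j : Fin m → Fin n),
    E (List.ofFn (fun t => conjEntry U X (i t) (j t))).prod
      = E (List.ofFn (fun t => X (i t) (j t))).prod

/-- `κ_{(V,π)} = k_V(X_{1π(1)}, …, X_{mπ(m)})`. -/
def kappa {n : ℕ} (k : ∀ {l : ℕ}, Setoid (Fin l) → (Fin l → A) → ℂ)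
    (X : Matrix (Fin n) (Fin n) A) {m : ℕ} (h : m ≤ n)
    (V : Setoid (Fin m)) (π : Equiv.Perm (Fin m)) : ℂ :=
  k V (fun t => X (Fin.castLE h t) (Fin.castLE h (π t)))

/-- The sequence `n ↦ κ_{(V,π)}(X_n)` (with junk value `0` for `n < m`). -/
def kappaSeq {A : ℕ → Type*} (k : ∀ n, ∀ {l : ℕ}, Setoid (Fin l) → (Fin l → A n) → ℂ)
    (X : ∀ n, Matrix (Fin n) (Fin n) (A n)) {m : ℕ}
    (V : Setoid (Fin m)) (π : Equiv.Perm (Fin m)) (n : ℕ) : ℂ :=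
  if h : m ≤ n then kappa (k n) (X n) h V π else 0

/-- Normalized trace of a matrix with entries in a `ℂ`-algebra. -/
def ncTrace [Ring A] [Algebra ℂ A] {n : ℕ} (X : Matrix (Fin n) (Fin n) A) : A :=
  ((n : ℂ)⁻¹) • Matrix.trace X

/-- Partial sums `p₁ + ⋯ + p_j`. -/
def psum {l : ℕ} (p : Fin l → ℕ) (j : ℕ) : ℕ := ∑ i : Fin l, if (i : ℕ) < j then p i else 0

/-- `γ` is the permutation with the cycles `(1,…,p₁)(p₁+1,…,p₁+p₂)⋯`. -/
def IsCycleType {l k : ℕ} (p : Fin l → ℕ) (γ : Equiv.Perm (Fin k)) : Prop :=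
  psum p l = k ∧
  (∀ (j : ℕ), j < l → ∀ t : Fin k, psum p j ≤ (t : ℕ) → (t : ℕ) + 1 < psum p (j + 1) →
    ((γ t : Fin k) : ℕ) = (t : ℕ) + 1) ∧
  (∀ (j : ℕ), j < l → ∀ t : Fin k, (t : ℕ) + 1 = psum p (j + 1) → ((γ t : Fin k) : ℕ) = psum p j)

/-- The section `Fin (m-1) → Fin m` merging `i` and `i+1` (both are hit by `i`). -/
def mergeEmb (m i : ℕ) (_hi : i + 1 < m) (t : Fin (m - 1)) : Fin m :=
  if (t : ℕ) ≤ i then ⟨t, by have := t.isLt; omega⟩ else ⟨(t : ℕ) + 1, by have := t.isLt; omega⟩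

/-- The partition of `{1,…,m-1}` obtained from a partition of `{1,…,m}` by merging the
elements `i` and `i+1` into a single element. -/
def mergeSetoid {m : ℕ} (W : Setoid (Fin m)) (i : ℕ) (hi : i + 1 < m) : Setoid (Fin (m - 1)) :=
  Setoid.comap (mergeEmb m i hi) W

/-- The tuple `(a₁, …, a_{i-1}, [a_i, a_{i+1}], a_{i+2}, …, a_m)` of length `m-1`. -/
def mergeSeq [Ring A] {m : ℕ} (a : Fin m → A) (i : ℕ) (hi : i + 1 < m)
    (t : Fin (m - 1)) : A :=
  if (t : ℕ) < i then a ⟨t, by have := t.isLt; omega⟩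
  else if (t : ℕ) = i then
    a ⟨i, by omega⟩ * a ⟨i + 1, hi⟩ - a ⟨i + 1, hi⟩ * a ⟨i, by omega⟩
  else a ⟨(t : ℕ) + 1, by have := t.isLt; omega⟩


/-- The sequence `(X_n)` has asymptotically vanishing commutators up to degree `m₀`:
for every partitioned permutation `(V,π)` of `{1,…,m}` with `m ≤ m₀` and neighboring indices
`i`, `i+1` lying in the same block of `V`, the cumulant (over the merged partition) of the tuple
`(X_{1π(1)},…,[X_{iπ(i)},X_{i+1,π(i+1)}],…,X_{mπ(m)})` is `o(n^{-|(V,π)|})`. -/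
def AsympVanishingComm {A : ℕ → Type*} [∀ n, Ring (A n)]
    (k : ∀ n, ∀ {l : ℕ}, Setoid (Fin l) → (Fin l → A n) → ℂ)
    (X : ∀ n, Matrix (Fin n) (Fin n) (A n)) (m₀ : ℕ) : Prop :=
  ∀ (m : ℕ), m ≤ m₀ →
    ∀ (V : Setoid (Fin m)) (π : Equiv.Perm (Fin m)), permLePartition π V →
    ∀ (i : ℕ) (hi : i + 1 < m), V.r ⟨i, by omega⟩ ⟨i + 1, hi⟩ →
      Tendsto (fun n : ℕ => (n : ℂ) ^ (ppLen V π) *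
          (if h : m ≤ n then
            k n (mergeSetoid V i hi)
              (mergeSeq (fun t => X n (Fin.castLE h t) (Fin.castLE h (π t))) i hi)
          else 0))
        atTop (nhds 0)

/-! ### Uniqueness of Möbius inversion -/

/-- A function on a finite poset is determined, on a lower set, by its sums over principal
lower sets. -/
theorem eq_of_sum_le_eq {α M : Type*} [PartialOrder α] [Fintype α] [AddCommGroup M]
    {p : α → Prop} (hp : ∀ a b, a ≤ b → p b → p a) {f g : α → M}
    (h : ∀ V, p V → ∑ W ∈ Finset.univ.filter (fun W => W ≤ V), f W
      = ∑ W ∈ Finset.univ.filter (fun W => W ≤ V), g W) (V : α) (hV : p V) :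
    f V = g V := by
  induction V using WellFoundedLT.induction with
  | ind V ih =>
    have hs : Finset.univ.filter (fun W => W ≤ V)
        = insert V (Finset.univ.filter (fun W => W < V)) := by
      ext W
      simp [le_iff_eq_or_lt]
    have h1 := h V hV
    rw [hs, Finset.sum_insert (by simp), Finset.sum_insert (by simp),
      Finset.sum_congr rfl fun W hW => ih W (Finset.mem_filter.1 hW).2
        (hp W V (Finset.mem_filter.1 hW).2.le hV)] at h1
    exact add_right_cancel h1

/-! ### Ordered products -/

theorem ordProd_eq_of_pairwise [Monoid A] {l : ℕ} (a : Fin l → A) (S : Set (Fin l))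
    (L : List (Fin l)) (hL : L.Pairwise (· < ·)) (h : ∀ x, x ∈ L ↔ x ∈ S) :
    ordProd a S = (L.map a).prod := by
  unfold ordProd
  congr 2
  refine List.Pairwise.eq_of_mem_iff (r := (· < ·)) ?_ hL fun x => ?_
  · exact (List.pairwise_lt_finRange l).filter _
  · simp [h]

theorem ordProd_image [Monoid A] {l m : ℕ} (a : Fin m → A) (e : Fin l → Fin m)
    (S : Set (Fin l)) (he : StrictMonoOn e S) :
    ordProd a (e '' S) = ordProd (a ∘ e) S := by
  rw [ordProd_eq_of_pairwise a (e '' S)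
    (((List.finRange l).filter (fun i => decide (i ∈ S))).map e), List.map_map]
  · rfl
  · rw [List.pairwise_map]
    refine List.Pairwise.imp_of_mem ?_ ((List.pairwise_lt_finRange l).filter _)
    intro x y hx hy hxy
    simp only [List.mem_filter, decide_eq_true_eq] at hx hy
    exact he hx.2 hy.2 hxy
  · intro x
    simp

theorem ordProd_preimage [Monoid A] {l m : ℕ} (a : Fin m → A) (q : Fin m → Fin l)
    (hq : Monotone q) (S : Set (Fin l)) :
    ordProd a (q ⁻¹' S) = ordProd (fun j => ordProd a (q ⁻¹' {j})) S := by
  rw [ordProd_eq_of_pairwise a (q ⁻¹' S)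
    (((List.finRange l).filter (fun i => decide (i ∈ S))).flatMap
      fun j => (List.finRange m).filter (fun i => decide (i ∈ q ⁻¹' {j})))]
  · rw [List.map_flatMap, List.flatMap_def, List.prod_flatten, List.map_map]
    rfl
  · rw [List.pairwise_flatMap]
    refine ⟨fun j _ => (List.pairwise_lt_finRange m).filter _, ?_⟩
    refine ((List.pairwise_lt_finRange l).filter _).imp ?_
    intro i j hij x hx y hy
    simp only [List.mem_filter, decide_eq_true_eq, Set.mem_preimage,
      Set.mem_singleton_iff] at hx hy
    by_contra hxy
    have := hq (not_lt.1 hxy)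
    rw [hx.2, hy.2] at this
    exact absurd hij (not_lt.2 this)
  · intro x
    simp

theorem ordProd_congr [Monoid A] {l : ℕ} {a b : Fin l → A} {S : Set (Fin l)}
    (h : ∀ t ∈ S, a t = b t) : ordProd a S = ordProd b S := by
  unfold ordProd
  congr 1
  refine List.map_congr_left fun t ht => h t ?_
  simpa using ht

theorem exists_ordProd_update [Monoid A] {l : ℕ} (a : Fin l → A) {S : Set (Fin l)} {t : Fin l}
    (ht : t ∈ S) : ∃ L R : A, ∀ x, ordProd (Function.update a t x) S = L * x * R := by
  have hmem : t ∈ (List.finRange l).filter (fun i => decide (i ∈ S)) := by simpa using ht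
  obtain ⟨L₁, L₂, hL⟩ := List.append_of_mem hmem
  have hnd : ((List.finRange l).filter (fun i => decide (i ∈ S))).Nodup :=
    (List.nodup_finRange l).filter _
  rw [hL, List.nodup_middle, List.nodup_cons, List.mem_append, not_or] at hnd
  refine ⟨(L₁.map a).prod, (L₂.map a).prod, fun x => ?_⟩
  have key : ∀ L : List (Fin l), t ∉ L → L.map (Function.update a t x) = L.map a := by
    intro L htL
    refine List.map_congr_left fun s hs => Function.update_of_ne ?_ _ _
    rintro rfl
    exact htL hs
  unfold ordProd
  rw [hL, List.map_append, List.map_cons, key _ hnd.1.1, key _ hnd.1.2, List.prod_append,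
    List.prod_cons, Function.update_self, mul_assoc]

/-! ### Moment functionals -/

theorem classes_eq_range {l : ℕ} {β : Type*} (V : Setoid (Fin l)) (r : Fin l → β)
    (hr : Function.Surjective r) (hV : ∀ s t, V s t ↔ r s = r t) :
    Setoid.classes V = Set.range fun b : β => r ⁻¹' {b} := by
  ext B
  constructor
  · rintro ⟨t, rfl⟩
    exact ⟨r t, by ext s; simpa using (hV s t).symm⟩
  · rintro ⟨b, rfl⟩
    obtain ⟨t, rfl⟩ := hr b
    exact ⟨t, by ext s; simpa using (hV s t).symm⟩

theorem preimage_singleton_injective {α β : Type*} {r : α → β} (hr : Function.Surjective r) :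
    Function.Injective fun b : β => r ⁻¹' {b} := by
  intro b c h
  obtain ⟨t, rfl⟩ := hr b
  have : t ∈ r ⁻¹' {c} := by
    rw [← show r ⁻¹' {r t} = r ⁻¹' {c} from h]
    rfl
  exact this

theorem momentV_eq_prod [Monoid A] {R : Type*} [CommRing R] {l : ℕ} {β : Type*} [Fintype β]
    (E : A → R) (V : Setoid (Fin l)) (a : Fin l → A) (r : Fin l → β)
    (hr : Function.Surjective r) (hV : ∀ s t, V s t ↔ r s = r t) :
    momentV E V a = ∏ b : β, E (ordProd a (r ⁻¹' {b})) := by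
  unfold momentV
  rw [classes_eq_range V r hr hV, finprod_mem_range (preimage_singleton_injective hr),
    finprod_eq_prod_of_fintype]

theorem numBlocks_eq_card {l : ℕ} {β : Type*} [Fintype β] (V : Setoid (Fin l)) (r : Fin l → β)
    (hr : Function.Surjective r) (hV : ∀ s t, V s t ↔ r s = r t) :
    numBlocks V = Fintype.card β := by
  unfold numBlocks
  rw [classes_eq_range V r hr hV, ← Set.image_univ,
    Set.ncard_image_of_injective _ (preimage_singleton_injective hr), Set.ncard_univ,
    Nat.card_eq_fintype_card]

theorem numBlocks_eq_card_quotient {l : ℕ} (V : Setoid (Fin l)) :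
    numBlocks V = Fintype.card (Quotient V) :=
  numBlocks_eq_card V (Quotient.mk V) Quotient.mk_surjective fun _ _ => Quotient.eq.symm

theorem momentV_eq_prod_quotient [Monoid A] {R : Type*} [CommRing R] {l : ℕ}
    (E : A → R) (V : Setoid (Fin l)) (a : Fin l → A) :
    momentV E V a = ∏ c : Quotient V, E (ordProd a (Quotient.mk V ⁻¹' {c})) :=
  momentV_eq_prod E V a (Quotient.mk V) Quotient.mk_surjective fun _ _ => Quotient.eq.symm

theorem momentV_comap [Monoid A] {R : Type*} [CommRing R] {l m : ℕ} (E : A → R)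
    (U : Setoid (Fin l)) (a : Fin m → A) (q : Fin m → Fin l) (hq : Monotone q)
    (hqs : Function.Surjective q) :
    momentV E (Setoid.comap q U) a = momentV E U fun j => ordProd a (q ⁻¹' {j}) := by
  rw [momentV_eq_prod_quotient E U, momentV_eq_prod E (Setoid.comap q U) a (Quotient.mk U ∘ q)
    (Quotient.mk_surjective.comp hqs) fun s t => by
      rw [Setoid.comap_rel]; exact Quotient.eq.symm]
  refine Finset.prod_congr rfl fun c _ => ?_
  rw [Set.preimage_comp, ordProd_preimage a q hq]

/-- Reordering the arguments along a bijection that is increasing on each block. -/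
theorem momentV_comp_perm [Monoid A] {R : Type*} [CommRing R] {l : ℕ} (E : A → R)
    (V : Setoid (Fin l)) (a : Fin l → A) (s : Equiv.Perm (Fin l))
    (hs : ∀ x y, V x y → x < y → s x < s y) :
    momentV E V (a ∘ s) = momentV E (Setoid.comap s.symm V) a := by
  rw [momentV_eq_prod_quotient E V, momentV_eq_prod E (Setoid.comap s.symm V) a
    (Quotient.mk V ∘ s.symm) (Quotient.mk_surjective.comp s.symm.surjective) fun s t => by
      rw [Setoid.comap_rel]; exact Quotient.eq.symm]
  refine Finset.prod_congr rfl fun c _ => ?_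
  rw [Set.preimage_comp, ← Equiv.image_eq_preimage_symm, ordProd_image]
  intro x hx y hy hxy
  exact hs x y (Quotient.exact (hx.trans hy.symm)) hxy

/-- Factorization of moments along a saturated splitting of the index set. -/
theorem momentV_sum [Monoid A] {R : Type*} [CommRing R] {l m₁ m₂ : ℕ} (E : A → R)
    (V : Setoid (Fin l)) (a : Fin l → A) (e : Fin m₁ ⊕ Fin m₂ ≃ Fin l)
    (h₁ : StrictMono (e ∘ Sum.inl)) (h₂ : StrictMono (e ∘ Sum.inr))
    (hV : ∀ x y, ¬ V (e (Sum.inl x)) (e (Sum.inr y))) :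
    momentV E V a = momentV E (Setoid.comap (e ∘ Sum.inl) V) (a ∘ e ∘ Sum.inl)
      * momentV E (Setoid.comap (e ∘ Sum.inr) V) (a ∘ e ∘ Sum.inr) := by
  rw [momentV_eq_prod_quotient E (Setoid.comap (e ∘ Sum.inl) V),
    momentV_eq_prod_quotient E (Setoid.comap (e ∘ Sum.inr) V),
    momentV_eq_prod E V a (Sum.map (Quotient.mk (Setoid.comap (e ∘ Sum.inl) V))
      (Quotient.mk (Setoid.comap (e ∘ Sum.inr) V)) ∘ e.symm), Fintype.prod_sum_type]
  · congr 1 <;> refine Finset.prod_congr rfl fun c _ => ?_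
    · rw [← ordProd_image a _ _ (h₁.strictMonoOn _)]
      congr 2
      ext t
      obtain ⟨x | x, rfl⟩ := e.surjective t <;> simp
    · rw [← ordProd_image a _ _ (h₂.strictMonoOn _)]
      congr 2
      ext t
      obtain ⟨x | x, rfl⟩ := e.surjective t <;> simp
  · exact (Function.Surjective.sumMap Quotient.mk_surjective Quotient.mk_surjective).comp
      e.symm.surjective
  · intro s t
    obtain ⟨x | x, rfl⟩ := e.surjective s <;> obtain ⟨y | y, rfl⟩ := e.surjective t
    · simp [Quotient.eq, Setoid.comap_rel]
    · simpa using hV x y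
    · simpa using fun h => hV y x (V.symm h)
    · simp [Quotient.eq, Setoid.comap_rel]

theorem numBlocks_sum {l m₁ m₂ : ℕ} (V : Setoid (Fin l)) (e : Fin m₁ ⊕ Fin m₂ ≃ Fin l)
    (hV : ∀ x y, ¬ V (e (Sum.inl x)) (e (Sum.inr y))) :
    numBlocks V = numBlocks (Setoid.comap (e ∘ Sum.inl) V)
      + numBlocks (Setoid.comap (e ∘ Sum.inr) V) := by
  rw [numBlocks_eq_card_quotient (Setoid.comap (e ∘ Sum.inl) V),
    numBlocks_eq_card_quotient (Setoid.comap (e ∘ Sum.inr) V),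
    numBlocks_eq_card V (Sum.map (Quotient.mk (Setoid.comap (e ∘ Sum.inl) V))
      (Quotient.mk (Setoid.comap (e ∘ Sum.inr) V)) ∘ e.symm), Fintype.card_sum]
  · exact (Function.Surjective.sumMap Quotient.mk_surjective Quotient.mk_surjective).comp
      e.symm.surjective
  · intro s t
    obtain ⟨x | x, rfl⟩ := e.surjective s <;> obtain ⟨y | y, rfl⟩ := e.surjective t
    · simp [Quotient.eq, Setoid.comap_rel]
    · simpa using hV x y
    · simpa using fun h => hV y x (V.symm h)
    · simp [Quotient.eq, Setoid.comap_rel]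

theorem exists_linearMap_momentV_update [Ring A] [Algebra ℂ A] (E : A →ₗ[ℂ] ℂ) {l : ℕ}
    (V : Setoid (Fin l)) (a : Fin l → A) (t : Fin l) :
    ∃ φ : A →ₗ[ℂ] ℂ, ∀ x, momentV E V (Function.update a t x) = φ x := by
  obtain ⟨L, R, h⟩ := exists_ordProd_update a
    (show t ∈ Quotient.mk V ⁻¹' {Quotient.mk V t} from rfl)
  refine ⟨(∏ c ∈ Finset.univ.erase (Quotient.mk V t), E (ordProd a (Quotient.mk V ⁻¹' {c}))) •
    (E ∘ₗ LinearMap.mulLeft ℂ L ∘ₗ LinearMap.mulRight ℂ R), fun x => ?_⟩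
  rw [momentV_eq_prod_quotient, ← Finset.prod_erase_mul _ _ (Finset.mem_univ (Quotient.mk V t)),
    h x, Finset.prod_congr rfl fun c hc => by
      rw [ordProd_congr (b := a) fun s hs => Function.update_of_ne (by
        rintro rfl
        exact (Finset.mem_erase.1 hc).1 hs.symm) _ _]]
  simp [mul_assoc]

/-! ### Tensor cumulants -/

theorem sup_ker_eq_comap_iff {α β : Type*} {q : α → β} (hq : Function.Surjective q)
    (W : Setoid α) (U : Setoid β) :
    W ⊔ Setoid.ker q = Setoid.comap q U
      ↔ Setoid.comap (Function.surjInv hq) (W ⊔ Setoid.ker q) = U := by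
  have hS : ∀ x, (W ⊔ Setoid.ker q) (Function.surjInv hq (q x)) x := fun x =>
    (le_sup_right : Setoid.ker q ≤ W ⊔ Setoid.ker q) (Function.surjInv_eq hq (q x))
  constructor
  · intro h
    rw [h]
    ext x y
    simp [Setoid.comap_rel, Function.surjInv_eq]
  · rintro rfl
    ext x y
    change (W ⊔ Setoid.ker q) x y ↔
      (W ⊔ Setoid.ker q) (Function.surjInv hq (q x)) (Function.surjInv hq (q y))
    exact ⟨fun h => Setoid.trans' _ (hS x) (Setoid.trans' _ h (Setoid.symm' _ (hS y))),
      fun h => Setoid.trans' _ (Setoid.symm' _ (hS x)) (Setoid.trans' _ h (hS y))⟩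

section Cumulant

variable {R : Type*} [CommRing R] [Monoid A] {E : A → R}
  {k : ∀ {l : ℕ}, Setoid (Fin l) → (Fin l → A) → R}

/-- Cumulants of products. -/
theorem IsCumulant.prod_formula (hk : IsCumulant E k) {l m : ℕ} (q : Fin m → Fin l)
    (hq : Monotone q) (hqs : Function.Surjective q) (a : Fin m → A) (U : Setoid (Fin l)) :
    k U (fun j => ordProd a (q ⁻¹' {j}))
      = ∑ W ∈ Finset.univ.filter
          (fun W : Setoid (Fin m) => W ⊔ Setoid.ker q = Setoid.comap q U), k W a := by
  refine eq_of_sum_le_eq (p := fun _ => True) (fun _ _ _ _ => trivial)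
    (f := fun U => k U (fun j => ordProd a (q ⁻¹' {j})))
    (g := fun U => ∑ W ∈ Finset.univ.filter
          (fun W : Setoid (Fin m) => W ⊔ Setoid.ker q = Setoid.comap q U), k W a)
    (fun V _ => ?_) U trivial
  rw [hk, ← momentV_comap E V a q hq hqs, ← hk]
  have hle : ∀ W, W ≤ Setoid.comap q V ↔
      Setoid.comap (Function.surjInv hqs) (W ⊔ Setoid.ker q) ≤ V := by
    intro W
    have h1 := (sup_ker_eq_comap_iff hqs W _).2 rfl
    constructor
    · intro h x y hxy
      have h2 : W ⊔ Setoid.ker q ≤ Setoid.comap q V := by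
        refine sup_le h fun x y hxy => ?_
        rw [Setoid.comap_rel, show q x = q y from hxy]
      simpa [Setoid.comap_rel, Function.surjInv_eq] using h2 hxy
    · intro h
      refine le_sup_left.trans (h1.le.trans fun x y hxy => ?_)
      exact h hxy
  rw [← Finset.sum_fiberwise_of_maps_to (t := Finset.univ.filter (fun U => U ≤ V))
    (g := fun W => Setoid.comap (Function.surjInv hqs) (W ⊔ Setoid.ker q))
    (fun W hW => by simpa using (hle W).1 (Finset.mem_filter.1 hW).2)]
  refine Finset.sum_congr rfl fun U hU => Finset.sum_congr ?_ fun _ _ => rfl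
  ext W
  simp only [Finset.mem_filter, Finset.mem_univ, true_and, sup_ker_eq_comap_iff hqs, hle]
  refine ⟨fun h => h.2, fun h => ⟨?_, h⟩⟩
  rw [h]
  exact (Finset.mem_filter.1 hU).2

/-- Reordering the arguments along a bijection that is increasing on each block. -/
theorem IsCumulant.comp_perm (hk : IsCumulant E k) {l : ℕ} (V : Setoid (Fin l)) (a : Fin l → A)
    (s : Equiv.Perm (Fin l)) (hs : ∀ x y, V x y → x < y → s x < s y) :
    k V (a ∘ s) = k (Setoid.comap s.symm V) a := by
  refine eq_of_sum_le_eq (p := fun V : Setoid (Fin l) => ∀ x y, V x y → x < y → s x < s y)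
    (fun U V hUV hV x y hxy => hV x y (Setoid.le_def.1 hUV hxy))
    (f := fun V => k V (a ∘ s)) (g := fun V => k (Setoid.comap s.symm V) a)
    (fun V hV => ?_) V hs
  rw [hk, momentV_comp_perm E V a s hV, ← hk]
  refine Finset.sum_nbij' (fun W => Setoid.comap s W) (fun W => Setoid.comap s.symm W) ?_ ?_ ?_ ?_ ?_
  · intro W hW
    simp only [Finset.mem_filter, Finset.mem_univ, true_and] at hW ⊢
    intro x y hxy
    simpa [Setoid.comap_rel] using hW hxy
  · intro W hW
    simp only [Finset.mem_filter, Finset.mem_univ, true_and] at hW ⊢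
    exact fun x y hxy => hW hxy
  · intro W _
    ext x y
    simp [Setoid.comap_rel]
  · intro W _
    ext x y
    simp [Setoid.comap_rel]
  · intro W _
    congr 1
    ext x y
    simp [Setoid.comap_rel]

/-- Factorization of cumulants along a saturated splitting of the index set. -/
theorem IsCumulant.mul_of_splitting (hk : IsCumulant E k) {l m₁ m₂ : ℕ} (V : Setoid (Fin l))
    (a : Fin l → A) (e : Fin m₁ ⊕ Fin m₂ ≃ Fin l)
    (h₁ : StrictMono (e ∘ Sum.inl)) (h₂ : StrictMono (e ∘ Sum.inr))
    (hV : ∀ x y, ¬ V (e (Sum.inl x)) (e (Sum.inr y))) :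
    k V a = k (Setoid.comap (e ∘ Sum.inl) V) (a ∘ e ∘ Sum.inl)
      * k (Setoid.comap (e ∘ Sum.inr) V) (a ∘ e ∘ Sum.inr) := by
  refine eq_of_sum_le_eq (p := fun V : Setoid (Fin l) => ∀ x y, ¬ V (e (Sum.inl x)) (e (Sum.inr y)))
    (fun U V hUV hV x y hxy => hV x y (Setoid.le_def.1 hUV hxy)) (f := fun V => k V a)
    (g := fun V => k (Setoid.comap (e ∘ Sum.inl) V) (a ∘ e ∘ Sum.inl)
      * k (Setoid.comap (e ∘ Sum.inr) V) (a ∘ e ∘ Sum.inr)) (fun V hV => ?_) V hV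
  rw [hk, momentV_sum E V a e h₁ h₂ hV, ← hk, ← hk, Finset.sum_mul_sum, ← Finset.sum_product']
  symm
  refine Finset.sum_nbij' (fun W => (Setoid.comap (e ∘ Sum.inl) W, Setoid.comap (e ∘ Sum.inr) W))
    (fun W => Setoid.ker (Sum.map (Quotient.mk W.1) (Quotient.mk W.2) ∘ e.symm)) ?_ ?_ ?_ ?_ ?_
  · intro W hW
    simp only [Finset.mem_filter, Finset.mem_univ, true_and, Finset.mem_product] at hW ⊢
    exact ⟨fun x y hxy => hW hxy, fun x y hxy => hW hxy⟩
  · intro W hW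
    simp only [Finset.mem_filter, Finset.mem_univ, true_and, Finset.mem_product] at hW ⊢
    intro s t
    obtain ⟨x | x, rfl⟩ := e.surjective s <;> obtain ⟨y | y, rfl⟩ := e.surjective t
    · simpa [Setoid.ker_def, Quotient.eq, Setoid.comap_rel] using Setoid.le_def.1 hW.1
    · simp [Setoid.ker_def]
    · simp [Setoid.ker_def]
    · simpa [Setoid.ker_def, Quotient.eq, Setoid.comap_rel] using Setoid.le_def.1 hW.2
  · intro W hW
    simp only [Finset.mem_filter, Finset.mem_univ, true_and] at hW
    ext s t
    obtain ⟨x | x, rfl⟩ := e.surjective s <;> obtain ⟨y | y, rfl⟩ := e.surjective t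
    · simp [Setoid.ker_def, Quotient.eq, Setoid.comap_rel]
    · simpa [Setoid.ker_def] using fun h => hV x y (hW h)
    · simpa [Setoid.ker_def] using fun h => hV y x (V.symm (hW h))
    · simp [Setoid.ker_def, Quotient.eq, Setoid.comap_rel]
  · rintro ⟨W₁, W₂⟩ _
    ext s t <;> simp [Setoid.ker_def, Quotient.eq, Setoid.comap_rel]
  · intro W _
    rfl

end Cumulant

section Linear

variable [Ring A] [Algebra ℂ A] {E : A →ₗ[ℂ] ℂ}
  {k : ∀ {l : ℕ}, Setoid (Fin l) → (Fin l → A) → ℂ}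

theorem IsCumulant.exists_linearMap_update (hk : IsCumulant E k) {l : ℕ} (V : Setoid (Fin l))
    (a : Fin l → A) (t : Fin l) :
    ∃ φ : A →ₗ[ℂ] ℂ, ∀ x, k V (Function.update a t x) = φ x := by
  induction V using WellFoundedLT.induction with
  | ind V ih =>
    choose! φ hφ using ih
    obtain ⟨ψ, hψ⟩ := exists_linearMap_momentV_update E V a t
    refine ⟨ψ - ∑ W ∈ Finset.univ.filter (fun W => W < V), φ W, fun x => ?_⟩
    have hs : Finset.univ.filter (fun W => W ≤ V)
        = insert V (Finset.univ.filter (fun W => W < V)) := by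
      ext W
      simp [le_iff_eq_or_lt]
    have h := hk l V (Function.update a t x)
    rw [hs, Finset.sum_insert (by simp), hψ,
      Finset.sum_congr rfl fun W hW => hφ W (Finset.mem_filter.1 hW).2 x] at h
    rw [LinearMap.sub_apply, LinearMap.sum_apply, ← h, add_sub_cancel_right]

/-- Cumulants as multilinear maps. -/
def IsCumulant.toMultilinearMap (hk : IsCumulant E k) {l : ℕ} (V : Setoid (Fin l)) :
    MultilinearMap ℂ (fun _ : Fin l => A) ℂ :=
  MultilinearMap.mk' (k V)
    (fun a t x y => by
      obtain ⟨φ, hφ⟩ := hk.exists_linearMap_update V a t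
      rw [hφ, hφ, hφ, map_add])
    (fun a t c x => by
      obtain ⟨φ, hφ⟩ := hk.exists_linearMap_update V a t
      rw [hφ, hφ, map_smul])

theorem IsCumulant.map_sum_smul (hk : IsCumulant E k) {l : ℕ} (V : Setoid (Fin l))
    {ι : Fin l → Type*} [∀ t, Fintype (ι t)] (c : ∀ t, ι t → ℂ) (Y : ∀ t, ι t → A) :
    k V (fun t => ∑ x, c t x • Y t x)
      = ∑ x : ∀ t, ι t, (∏ t, c t (x t)) * k V (fun t => Y t (x t)) := by
  have h := (hk.toMultilinearMap V).map_sum (fun t x => c t x • Y t x)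
  refine h.trans (Finset.sum_congr rfl fun x _ => ?_)
  exact (hk.toMultilinearMap V).map_smul_univ (fun t => c t (x t)) (fun t => Y t (x t))

/-- Unitary invariance of cumulants, with a unitary matrix for each block. -/
theorem IsCumulant.conjEntry_eq (hk : IsCumulant E k) {n : ℕ} {X : Matrix (Fin n) (Fin n) A}
    (hX : UnitarilyInvariant E X) {m : ℕ} (V : Setoid (Fin m))
    (U : Fin m → Matrix (Fin n) (Fin n) ℂ) (hU : ∀ t, U t ∈ Matrix.unitaryGroup (Fin n) ℂ)
    (hUV : ∀ s t, V s t → U s = U t) (i j : Fin m → Fin n) :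
    k V (fun t => conjEntry (U t) X (i t) (j t)) = k V (fun t => X (i t) (j t)) := by
  refine eq_of_sum_le_eq (p := fun V : Setoid (Fin m) => ∀ s t, V s t → U s = U t)
    (fun U V hUV hV x y hxy => hV x y (Setoid.le_def.1 hUV hxy))
    (f := fun V => k V (fun t => conjEntry (U t) X (i t) (j t)))
    (g := fun V => k V (fun t => X (i t) (j t))) (fun V hV => ?_) V hUV
  rw [hk, hk, momentV_eq_prod_quotient, momentV_eq_prod_quotient]
  refine Finset.prod_congr rfl fun c _ => ?_
  obtain ⟨t₀, rfl⟩ := Quotient.mk_surjective c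
  rw [ordProd_congr (b := fun t => conjEntry (U t₀) X (i t) (j t)) fun t ht => by
    rw [hV t t₀ (Quotient.exact ht)]]
  unfold ordProd
  set L := (List.finRange m).filter (fun i => decide (i ∈ Quotient.mk V ⁻¹' {Quotient.mk V t₀}))
  have h := hX (U t₀) (hU t₀) L.length (fun s => i (L.get s)) (fun s => j (L.get s))
  have key : ∀ f : Fin m → A, L.map f = List.ofFn fun s => f (L.get s) := by
    intro f
    exact (congrArg (List.map f) (List.ofFn_get L)).symm.trans List.map_ofFn
  rw [key, key]
  exact h

end Linear

/-! ### Tensors commuting with all unitary Kronecker powers -/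

/-- The `m`-fold Kronecker power of a matrix. -/
def kronPow {n : ℕ} (m : ℕ) (B : Matrix (Fin n) (Fin n) ℂ) :
    Matrix (Fin m → Fin n) (Fin m → Fin n) ℂ :=
  Matrix.of fun i j => ∏ t, B (i t) (j t)

theorem kronPow_apply {n m : ℕ} (B : Matrix (Fin n) (Fin n) ℂ) (i j : Fin m → Fin n) :
    kronPow m B i j = ∏ t, B (i t) (j t) := rfl

theorem kronPow_mul {n : ℕ} (m : ℕ) (B C : Matrix (Fin n) (Fin n) ℂ) :
    kronPow m (B * C) = kronPow m B * kronPow m C := by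
  ext i j
  simp only [kronPow_apply, Matrix.mul_apply]
  rw [Finset.prod_univ_sum, Fintype.piFinset_univ]
  simp_rw [Finset.prod_mul_distrib]

theorem kronPow_one {n : ℕ} (m : ℕ) : kronPow m (1 : Matrix (Fin n) (Fin n) ℂ) = 1 := by
  ext i j
  rw [kronPow_apply, Matrix.one_apply]
  split_ifs with h
  · subst h
    simp
  · obtain ⟨t, ht⟩ := Function.ne_iff.1 h
    exact Finset.prod_eq_zero (Finset.mem_univ t) (Matrix.one_apply_ne ht)

theorem kronPow_diagonal {n m : ℕ} (d : Fin n → ℂ) :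
    kronPow m (Matrix.diagonal d) = Matrix.diagonal fun i => ∏ t, d (i t) := by
  ext i j
  rw [kronPow_apply, Matrix.diagonal_apply]
  split_ifs with h
  · subst h
    simp
  · obtain ⟨t, ht⟩ := Function.ne_iff.1 h
    exact Finset.prod_eq_zero (Finset.mem_univ t) (Matrix.diagonal_apply_ne _ ht)

theorem diagonal_mem_unitaryGroup {n : ℕ} (d : Fin n → ℂ) (hd : ∀ x, d x * star (d x) = 1) :
    Matrix.diagonal d ∈ Matrix.unitaryGroup (Fin n) ℂ := by
  rw [Matrix.mem_unitaryGroup_iff, Matrix.star_eq_conjTranspose, Matrix.diagonal_conjTranspose,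
    Matrix.diagonal_mul_diagonal, ← Matrix.diagonal_one]
  congr 1
  ext x
  simpa using hd x

section Commute

variable {n m : ℕ} {T : Matrix (Fin m → Fin n) (Fin m → Fin n) ℂ}

theorem commute_diagonal_iff {ι : Type*} [Fintype ι] [DecidableEq ι] (d : ι → ℂ)
    (T : Matrix ι ι ℂ) :
    Commute (Matrix.diagonal d) T ↔ ∀ i j, T i j ≠ 0 → d i = d j := by
  rw [commute_iff_eq, ← Matrix.ext_iff]
  refine forall₂_congr fun i j => ?_
  rw [Matrix.diagonal_mul, Matrix.mul_diagonal, mul_comm (T i j)]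
  constructor
  · exact fun h hT => mul_right_cancel₀ hT h
  · intro h
    by_cases hT : T i j = 0
    · simp [hT]
    · rw [h hT]

theorem commute_kronPow_diagonal
    (hT : ∀ U ∈ Matrix.unitaryGroup (Fin n) ℂ, Commute (kronPow m U) T) (d : Fin n → ℂ) :
    Commute (kronPow m (Matrix.diagonal d)) T := by
  rw [kronPow_diagonal, commute_diagonal_iff]
  intro i j hij
  have hcount : ∀ x, (Finset.univ.filter fun t => i t = x).card
      = (Finset.univ.filter fun t => j t = x).card := by
    intro x
    have hz := Complex.isPrimitiveRoot_exp (m + 1) (Nat.succ_ne_zero m)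
    set z := Complex.exp (2 * Real.pi * Complex.I / ((m + 1 : ℕ) : ℂ))
    have hz1 : z * star z = 1 := by
      rw [Complex.star_def, Complex.mul_conj, Complex.normSq_eq_norm_sq,
        hz.norm'_eq_one (Nat.succ_ne_zero m)]
      simp
    have h := hT (Matrix.diagonal fun y => if y = x then z else 1)
      (diagonal_mem_unitaryGroup _ fun y => by
        split_ifs
        · exact hz1
        · simp)
    rw [kronPow_diagonal, commute_diagonal_iff] at h
    have hp := h i j hij
    simp only [Finset.prod_ite, Finset.prod_const, one_pow, mul_one] at hp
    have hle : ∀ S : Finset (Fin m), S.card < m + 1 := fun S =>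
      Nat.lt_succ_of_le (S.card_le_univ.trans (Fintype.card_fin m).le)
    exact hz.pow_inj (hle _) (hle _) hp
  rw [← Finset.prod_fiberwise (g := i), ← Finset.prod_fiberwise (g := j)]
  refine Finset.prod_congr rfl fun x _ => ?_
  rw [Finset.prod_congr rfl (g := fun _ => d x) fun t ht => by rw [(Finset.mem_filter.1 ht).2],
    Finset.prod_const, Finset.prod_congr rfl (g := fun _ => d x) fun t ht => by
      rw [(Finset.mem_filter.1 ht).2], Finset.prod_const, hcount]

theorem commute_kronPow_hermitian
    (hT : ∀ U ∈ Matrix.unitaryGroup (Fin n) ℂ, Commute (kronPow m U) T)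
    {H : Matrix (Fin n) (Fin n) ℂ} (hH : H.IsHermitian) : Commute (kronPow m H) T := by
  rw [hH.spectral_theorem, Unitary.conjStarAlgAut_apply, kronPow_mul, kronPow_mul]
  exact ((hT _ hH.eigenvectorUnitary.2).mul_left (commute_kronPow_diagonal hT _)).mul_left
    (hT _ (star hH.eigenvectorUnitary).2)

open Polynomial in
/-- A tensor commuting with the Kronecker powers of all unitary matrices commutes with the
Kronecker powers of all matrices. -/
theorem commute_kronPow
    (hT : ∀ U ∈ Matrix.unitaryGroup (Fin n) ℂ, Commute (kronPow m U) T)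
    (B : Matrix (Fin n) (Fin n) ℂ) : Commute (kronPow m B) T := by
  obtain ⟨H, K, hH, hK, rfl⟩ : ∃ H K : Matrix (Fin n) (Fin n) ℂ, H.IsHermitian ∧ K.IsHermitian ∧
      B = H + Complex.I • K := by
    have h := realPart_add_I_smul_imaginaryPart B
    exact ⟨_, _, (realPart B).2, (imaginaryPart B).2, h.symm⟩
  rw [commute_iff_eq, ← Matrix.ext_iff]
  intro i j
  set P : ℂ[X] := (∑ x, (∏ t, (C (H (i t) (x t)) + X * C (K (i t) (x t)))) * C (T x j))
    - ∑ x, C (T i x) * ∏ t, (C (H (x t) (j t)) + X * C (K (x t) (j t))) with hP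
  have hev : ∀ z : ℂ, P.eval z
      = (kronPow m (H + z • K) * T) i j - (T * kronPow m (H + z • K)) i j := by
    intro z
    simp [hP, Polynomial.eval_finsetSum, Polynomial.eval_prod, Matrix.mul_apply, kronPow_apply,
      mul_comm z]
  have hP0 : P = 0 := by
    refine Polynomial.eq_zero_of_infinite_isRoot _
      ((Set.infinite_range_of_injective Complex.ofReal_injective).mono ?_)
    rintro _ ⟨r, rfl⟩
    rw [Set.mem_ofPred_eq, Polynomial.IsRoot, hev, sub_eq_zero]
    have hr : (H + (r : ℂ) • K).IsHermitian := by
      refine hH.add ?_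
      rw [Matrix.IsHermitian, Matrix.conjTranspose_smul, hK]
      simp
    rw [(commute_kronPow_hermitian hT hr).eq]
  have := hev Complex.I
  rw [hP0, Polynomial.eval_zero] at this
  exact (sub_eq_zero.1 this.symm)

/-- A tensor commuting with the Kronecker powers of all matrices is a combination of
permutation operators. -/
theorem apply_eq_sum_perm
    (hT : ∀ B, Commute (kronPow m B) T) {g : Fin m → Fin n} (hg : Function.Injective g)
    (i j : Fin m → Fin n) :
    T i j = ∑ σ : Equiv.Perm (Fin m), if j = i ∘ σ then T g (g ∘ σ) else 0 := by
  have hnil : ∀ y : Fin m → Fin n, T g y ≠ 0 → ∃ σ : Equiv.Perm (Fin m), y = g ∘ σ := by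
    intro y hy
    have h0 := fun d => (commute_diagonal_iff _ _).1
      ((kronPow_diagonal (m := m) d) ▸ hT (Matrix.diagonal d)) g y hy
    have hsurj : ∀ t, ∃ s, y s = g t := by
      intro t
      by_contra! hne
      have h1 := h0 fun x => if x = g t then 0 else 1
      rw [Finset.prod_eq_zero (Finset.mem_univ t) (by simp)] at h1
      simp [hne] at h1
    choose τ hτ using hsurj
    have hinj : Function.Injective τ := fun s t h => hg (by rw [← hτ, ← hτ, h])
    set σ := Equiv.ofBijective τ (Finite.injective_iff_bijective.1 hinj)
    refine ⟨σ.symm, ?_⟩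
    ext1 s
    rw [← σ.apply_symm_apply s]
    simp only [Function.comp_apply, Equiv.symm_apply_apply]
    exact hτ _
  set B : Matrix (Fin n) (Fin n) ℂ := Matrix.of fun x y => if ∃ s, g s = x ∧ i s = y then 1 else 0
    with hB
  have hBg : ∀ s y, B (g s) y = if i s = y then 1 else 0 := by
    intro s y
    simp only [hB, Matrix.of_apply]
    congr 1
    exact propext ⟨fun ⟨t, h1, h2⟩ => hg h1 ▸ h2, fun h => ⟨s, rfl, h⟩⟩
  have h1 := congrFun (congrFun (hT B).eq g) j
  rw [Matrix.mul_apply, Matrix.mul_apply, Finset.sum_eq_single i] at h1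
  rotate_left
  · intro x _ hx
    obtain ⟨t, ht⟩ := Function.ne_iff.1 hx
    rw [kronPow_apply, Finset.prod_eq_zero (Finset.mem_univ t), zero_mul]
    rw [hBg, if_neg (Ne.symm ht)]
  · simp
  rw [kronPow_apply, Finset.prod_eq_one (fun t _ => by rw [hBg, if_pos rfl]), one_mul] at h1
  rw [h1]
  have hsum : ∀ y, y ∉ Set.range (fun σ : Equiv.Perm (Fin m) => g ∘ σ) →
      T g y * kronPow m B y j = 0 := by
    intro y hy
    by_cases h : T g y = 0
    · rw [h, zero_mul]
    · obtain ⟨σ, rfl⟩ := hnil y h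
      exact absurd ⟨σ, rfl⟩ hy
  have hinj : Function.Injective (fun σ : Equiv.Perm (Fin m) => g ∘ σ) := by
    intro σ τ h
    ext1 s
    exact hg (congrFun h s)
  symm
  refine Fintype.sum_of_injective _ hinj _ _ hsum fun σ => ?_
  have hk : kronPow m B (g ∘ σ) j = if j = i ∘ σ then 1 else 0 := by
    rw [kronPow_apply]
    split_ifs with h
    · subst h
      exact Finset.prod_eq_one fun t _ => by rw [Function.comp_apply, hBg, if_pos (by rfl)]
    · obtain ⟨t, ht⟩ := Function.ne_iff.1 h
      refine Finset.prod_eq_zero (Finset.mem_univ t) ?_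
      rw [Function.comp_apply, hBg, if_neg fun h => ht h.symm]
  rw [hk]
  simp

end Commute

/-! ### Mixed cumulants of the entries of a unitarily invariant matrix -/

section Entries

variable [Ring A] [Algebra ℂ A] {E : A →ₗ[ℂ] ℂ}
  {k : ∀ {l : ℕ}, Setoid (Fin l) → (Fin l → A) → ℂ} {n : ℕ} {X : Matrix (Fin n) (Fin n) A}

theorem IsCumulant.conjEntry_expand (hk : IsCumulant E k) {m : ℕ} (V : Setoid (Fin m))
    (U : Fin m → Matrix (Fin n) (Fin n) ℂ) (X : Matrix (Fin n) (Fin n) A) (i j : Fin m → Fin n) :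
    k V (fun t => conjEntry (U t) X (i t) (j t))
      = ∑ x : Fin m → Fin n, ∑ y : Fin m → Fin n,
        (∏ t, U t (i t) (x t)) * k V (fun t => X (x t) (y t)) * ∏ t, star (U t (j t) (y t)) := by
  have h := hk.map_sum_smul V (ι := fun _ => Fin n × Fin n)
    (fun t z => U t (i t) z.1 * star (U t (j t) z.2)) (fun _ z => X z.1 z.2)
  simp only [Fintype.sum_prod_type] at h
  refine h.trans ?_
  rw [← Fintype.sum_prod_type']
  refine Fintype.sum_equiv (Equiv.arrowProdEquivProdArrow _ _ _) _ _ fun z => ?_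
  simp only [Equiv.arrowProdEquivProdArrow_apply, Finset.prod_mul_distrib]
  ring

theorem IsCumulant.commute_kronPow_entries (hk : IsCumulant E k) (hX : UnitarilyInvariant E X)
    {m : ℕ} (V : Setoid (Fin m)) (B : Matrix (Fin n) (Fin n) ℂ) :
    Commute (kronPow m B) (Matrix.of fun i j => k V (fun t => X (i t) (j t))) := by
  refine commute_kronPow (fun U hU => ?_) B
  set T : Matrix (Fin m → Fin n) (Fin m → Fin n) ℂ :=
    Matrix.of fun i j => k V (fun t => X (i t) (j t)) with hT
  have h1 : kronPow m U * T * kronPow m (star U) = T := by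
    ext i j
    have h2 := hk.conjEntry_expand V (fun _ => U) X i j
    rw [hk.conjEntry_eq hX V (fun _ => U) (fun _ => hU) (fun _ _ _ => rfl)] at h2
    rw [hT, Matrix.of_apply, h2, Matrix.mul_apply, Finset.sum_comm]
    refine Finset.sum_congr rfl fun y _ => ?_
    rw [Matrix.mul_apply, Finset.sum_mul]
    rfl
  rw [commute_iff_eq, ← mul_one (kronPow m U * T), ← kronPow_one,
    ← (Matrix.mem_unitaryGroup_iff').1 hU, kronPow_mul, ← mul_assoc, h1]

/-- Mixed cumulants of the entries are determined by the cumulants `κ_{(V,σ)}`. -/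
theorem IsCumulant.entries_eq_sum (hk : IsCumulant E k) (hX : UnitarilyInvariant E X)
    {m : ℕ} (h : m ≤ n) (V : Setoid (Fin m)) (i j : Fin m → Fin n) :
    k V (fun t => X (i t) (j t))
      = ∑ σ : Equiv.Perm (Fin m), if j = i ∘ σ then kappa k X h V σ else 0 :=
  apply_eq_sum_perm (T := Matrix.of fun i j => k V (fun t => X (i t) (j t)))
    (hk.commute_kronPow_entries hX V) (Fin.castLE_injective h) i j

theorem IsCumulant.kappa_of_injective (hk : IsCumulant E k) (hX : UnitarilyInvariant E X)
    {m : ℕ} (h : m ≤ n) (V : Setoid (Fin m)) (π : Equiv.Perm (Fin m)) {g : Fin m → Fin n}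
    (hg : Function.Injective g) :
    k V (fun t => X (g t) (g (π t))) = kappa k X h V π := by
  rw [hk.entries_eq_sum hX h V g (fun t => g (π t)), Finset.sum_eq_single π]
  · exact if_pos rfl
  · intro σ _ hσ
    refine if_neg fun h' => hσ ?_
    ext1 t
    exact (hg (congrFun h' t)).symm
  · simp

/-- The cumulant `κ_{(V,π)}` vanishes unless `(V,π)` is a partitioned permutation. -/
theorem IsCumulant.kappa_eq_zero (hk : IsCumulant E k) (hX : UnitarilyInvariant E X)
    {m : ℕ} (h : m ≤ n) (V : Setoid (Fin m)) (π : Equiv.Perm (Fin m))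
    (hπ : ¬ permLePartition π V) : kappa k X h V π = 0 := by
  obtain ⟨s, hs⟩ := not_forall.1 hπ
  change ¬ V s (π s) at hs
  set d : Fin m → Fin n → ℂ := fun t x =>
    if V s t ∧ x = Fin.castLE h (π s) then -1 else 1 with hd
  have hd1 : ∀ t x, d t x * star (d t x) = 1 := by
    intro t x
    simp only [hd]
    split_ifs <;> simp
  have hdiag : ∀ t a b, conjEntry (Matrix.diagonal (d t)) X a b
      = (d t a * star (d t b)) • X a b := by
    intro t a b
    unfold conjEntry
    rw [Finset.sum_eq_single a, Finset.sum_eq_single b]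
    · simp
    · intro y _ hy
      simp [Matrix.diagonal_apply_ne _ hy.symm]
    · simp
    · intro x _ hx
      simp [Matrix.diagonal_apply_ne _ hx.symm]
    · simp
  have h1 := hk.conjEntry_eq hX V (fun t => Matrix.diagonal (d t))
    (fun t => diagonal_mem_unitaryGroup _ (hd1 t))
    (fun t u htu => by
      have : ∀ x, d t x = d u x := fun x => by
        simp only [hd]
        congr 2
        exact propext ⟨fun h => V.trans h htu, fun h => V.trans h (V.symm htu)⟩
      rw [funext this])
    (Fin.castLE h) (fun t => Fin.castLE h (π t))
  simp only [hdiag] at h1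
  have h2 := (hk.toMultilinearMap V).map_smul_univ
    (fun t => d t (Fin.castLE h t) * star (d t (Fin.castLE h (π t))))
    (fun t => X (Fin.castLE h t) (Fin.castLE h (π t)))
  have h3 := h2.symm.trans h1
  have hprod : ∏ t, d t (Fin.castLE h t) * star (d t (Fin.castLE h (π t))) = -1 := by
    rw [Finset.prod_eq_single s]
    · have : ¬ (V s s ∧ Fin.castLE h s = Fin.castLE h (π s)) := by
        rintro ⟨h4, h5⟩
        rw [← Fin.castLE_injective h h5] at hs
        exact hs h4
      have h6 : V s s := V.refl s
      simp only [hd, if_neg this, h6]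
      simp
    · intro t _ ht
      have h4 : ¬ (V s t ∧ Fin.castLE h t = Fin.castLE h (π s)) := by
        rintro ⟨h4, h5⟩
        rw [Fin.castLE_injective h h5] at h4
        exact hs h4
      have h5 : ¬ (V s t ∧ Fin.castLE h (π t) = Fin.castLE h (π s)) := by
        rintro ⟨_, h5⟩
        exact ht (π.injective (Fin.castLE_injective h h5))
      simp only [hd, if_neg h4, if_neg h5]
      simp
    · simp
  rw [hprod] at h3
  change (-1 : ℂ) • kappa k X h V π = kappa k X h V π at h3
  rw [neg_one_smul] at h3
  exact self_eq_neg.1 h3.symm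

end Entries

/-! ### Lengths of partitioned permutations -/

theorem numBlocks_top {m : ℕ} (hm : 0 < m) : numBlocks (⊤ : Setoid (Fin m)) = 1 := by
  rw [numBlocks_eq_card ⊤ (fun _ => ()) (fun u => ⟨⟨0, hm⟩, rfl⟩) fun s t => by simp,
    Fintype.card_unit]

theorem numBlocks_bot {m : ℕ} : numBlocks (⊥ : Setoid (Fin m)) = m := by
  rw [numBlocks_eq_card ⊥ id Function.surjective_id fun s t => by simp,
    Fintype.card_fin]

theorem numBlocks_le {m : ℕ} (V : Setoid (Fin m)) : numBlocks V ≤ m := by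
  rw [numBlocks_eq_card_quotient]
  exact (Fintype.card_le_of_surjective _ Quotient.mk_surjective).trans (Fintype.card_fin m).le

theorem numBlocks_comap_perm {m : ℕ} (V : Setoid (Fin m)) (s : Equiv.Perm (Fin m)) :
    numBlocks (Setoid.comap s V) = numBlocks V := by
  rw [numBlocks_eq_card_quotient V, numBlocks_eq_card (Setoid.comap s V) (Quotient.mk V ∘ s)
    (Quotient.mk_surjective.comp s.surjective) fun x y => by
      rw [Setoid.comap_rel]; exact Quotient.eq.symm]

theorem cycleSetoid_rel {m : ℕ} (π : Equiv.Perm (Fin m)) (x y : Fin m) :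
    cycleSetoid π x y ↔ π.SameCycle x y := Iff.rfl

theorem cycleSetoid_le_iff {m : ℕ} (π : Equiv.Perm (Fin m)) (V : Setoid (Fin m)) :
    cycleSetoid π ≤ V ↔ permLePartition π V := by
  constructor
  · exact fun h x => Setoid.le_def.1 h (show π.SameCycle x (π x) from ⟨1, by simp⟩)
  · intro h x y hxy
    obtain ⟨i, hi⟩ := Equiv.Perm.SameCycle.exists_nat_pow_eq hxy
    rw [← hi]
    clear hi hxy
    induction i with
    | zero => exact V.refl _
    | succ i ih =>
      rw [pow_succ', Equiv.Perm.mul_apply]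
      exact V.trans ih (h _)

theorem cycleSetoid_one {m : ℕ} : cycleSetoid (1 : Equiv.Perm (Fin m)) = ⊥ := by
  ext x y
  simp [cycleSetoid_rel]

theorem cycleSetoid_conj {m : ℕ} (π s : Equiv.Perm (Fin m)) :
    cycleSetoid (s * π * s⁻¹) = Setoid.comap s.symm (cycleSetoid π) := by
  ext x y
  rw [cycleSetoid_rel, Equiv.Perm.sameCycle_conj]
  rfl

theorem numCycles_conj {m : ℕ} (π s : Equiv.Perm (Fin m)) :
    numCycles (s * π * s⁻¹) = numCycles π := by
  rw [numCycles, cycleSetoid_conj, numBlocks_comap_perm, numCycles]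

theorem ppLen_conj {m : ℕ} (V : Setoid (Fin m)) (π s : Equiv.Perm (Fin m)) :
    ppLen (Setoid.comap s.symm V) (s * π * s⁻¹) = ppLen V π := by
  rw [ppLen, ppLen, numCycles_conj, numBlocks_comap_perm]

/-- The partition obtained by merging the blocks of `a` and `b`. -/
def joinPair {m : ℕ} (V : Setoid (Fin m)) (a b : Fin m) : Setoid (Fin m) :=
  Setoid.ker fun x => if V x a then Quotient.mk V b else Quotient.mk V x

theorem joinPair_le_iff {m : ℕ} (V S : Setoid (Fin m)) (a b : Fin m) :
    joinPair V a b ≤ S ↔ V ≤ S ∧ S a b := by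
  constructor
  · intro h
    refine ⟨fun x y hxy => Setoid.le_def.1 h ?_, Setoid.le_def.1 h ?_⟩
    · have : V x a ↔ V y a := ⟨fun h => V.trans (V.symm hxy) h, fun h => V.trans hxy h⟩
      have hq : Quotient.mk V x = Quotient.mk V y := Quotient.sound hxy
      change (if V x a then Quotient.mk V b else Quotient.mk V x)
        = if V y a then Quotient.mk V b else Quotient.mk V y
      rw [hq]
      simp only [this]
    · change (if V a a then Quotient.mk V b else Quotient.mk V a)
        = if V b a then Quotient.mk V b else Quotient.mk V b
      rw [if_pos (V.refl a), ite_self]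
  · rintro ⟨hV, hab⟩ x y hxy
    have key : ∀ x z, (if V x a then Quotient.mk V b else Quotient.mk V x) = Quotient.mk V z →
        S x z := by
      intro x z hxz
      split_ifs at hxz with hx
      · exact S.trans (hV hx) (S.trans hab (hV (Quotient.exact hxz)))
      · exact hV (Quotient.exact hxz)
    have hex : ∃ z, (if V y a then Quotient.mk V b else Quotient.mk V y) = Quotient.mk V z := by
      split_ifs
      exacts [⟨_, rfl⟩, ⟨_, rfl⟩]
    obtain ⟨z, hz⟩ := hex
    exact S.trans (key x z ((show _ = _ from hxy).trans hz)) (S.symm (key y z hz))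

theorem joinPair_eq_self {m : ℕ} {V : Setoid (Fin m)} {a b : Fin m} (h : V a b) :
    joinPair V a b = V :=
  le_antisymm ((joinPair_le_iff V V a b).2 ⟨le_rfl, h⟩)
    ((joinPair_le_iff V _ a b).1 le_rfl).1

theorem numBlocks_joinPair {m : ℕ} {V : Setoid (Fin m)} {a b : Fin m} (h : ¬ V a b) :
    numBlocks (joinPair V a b) + 1 = numBlocks V := by
  have hb : Quotient.mk V b ≠ Quotient.mk V a := fun h' => h (V.symm (Quotient.exact h'))
  have hne : ∀ x, (if V x a then Quotient.mk V b else Quotient.mk V x) ≠ Quotient.mk V a := by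
    intro x
    split_ifs with hx
    · exact hb
    · exact fun h' => hx (Quotient.exact h')
  rw [numBlocks_eq_card (joinPair V a b) (β := {c : Quotient V // c ≠ Quotient.mk V a})
    (fun x => ⟨if V x a then Quotient.mk V b else Quotient.mk V x, hne x⟩),
    numBlocks_eq_card_quotient, Fintype.card_subtype_compl, Fintype.card_subtype_eq]
  · exact Nat.sub_add_cancel (Fintype.card_pos_iff.2 ⟨Quotient.mk V a⟩)
  · rintro ⟨c, hc⟩
    obtain ⟨x, rfl⟩ := Quotient.mk_surjective c
    exact ⟨x, Subtype.ext (if_neg fun hx => hc (Quotient.sound hx))⟩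
  · intro x y
    rw [Subtype.mk.injEq]
    rfl

theorem numBlocks_joinPair_le {m : ℕ} (V : Setoid (Fin m)) (a b : Fin m) :
    numBlocks (joinPair V a b) ≤ numBlocks V ∧ numBlocks V ≤ numBlocks (joinPair V a b) + 1 := by
  by_cases h : V a b
  · rw [joinPair_eq_self h]
    exact ⟨le_rfl, Nat.le_succ _⟩
  · have := numBlocks_joinPair h
    omega

theorem joinPair_cycleSetoid_swap_mul {m : ℕ} (σ : Equiv.Perm (Fin m)) (a b : Fin m) :
    joinPair (cycleSetoid (Equiv.swap a b * σ)) a b = joinPair (cycleSetoid σ) a b := by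
  refine eq_of_forall_ge_iff fun S => ?_
  rw [joinPair_le_iff, joinPair_le_iff, cycleSetoid_le_iff, cycleSetoid_le_iff]
  refine and_congr_left fun hab => forall_congr' fun x => ?_
  change S x (Equiv.swap a b (σ x)) ↔ S x (σ x)
  have : ∀ y, S (Equiv.swap a b y) y := by
    intro y
    rw [Equiv.swap_apply_def]
    split_ifs with h1 h2
    · exact h1 ▸ S.symm hab
    · exact h2 ▸ hab
    · exact S.refl y
  exact ⟨fun h => S.trans h (this _), fun h => S.trans h (S.symm (this _))⟩

theorem sameCycle_swap_mul {m : ℕ} {σ : Equiv.Perm (Fin m)} {a b : Fin m}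
    (h : ¬ σ.SameCycle a b) : (Equiv.swap a b * σ).SameCycle a b := by
  by_contra hc
  have key : ∀ i : ℕ, (Equiv.swap a b * σ).SameCycle a ((σ ^ i) a) := by
    intro i
    induction i with
    | zero => exact Equiv.Perm.SameCycle.refl _ _
    | succ i ih =>
      have h1 : (Equiv.swap a b * σ).SameCycle a (Equiv.swap a b (σ ((σ ^ i) a))) :=
        Equiv.Perm.sameCycle_apply_right.2 ih
      rw [pow_succ', Equiv.Perm.mul_apply]
      by_cases ha : σ ((σ ^ i) a) = a
      · rw [ha, Equiv.swap_apply_left] at h1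
        exact absurd h1 hc
      · have hb : σ ((σ ^ i) a) ≠ b := by
          intro hb
          exact h ⟨(i : ℤ) + 1, by rw [add_comm, zpow_add]; simpa using hb⟩
        rwa [Equiv.swap_apply_of_ne_of_ne ha hb] at h1
  have h2 := key (orderOf σ - 1)
  have h3 : (Equiv.swap a b * σ) ((σ ^ (orderOf σ - 1)) a) = b := by
    rw [Equiv.Perm.mul_apply, ← Equiv.Perm.mul_apply σ, ← pow_succ',
      Nat.sub_add_cancel (orderOf_pos σ), pow_orderOf_eq_one]
    simp
  have h4 := Equiv.Perm.sameCycle_apply_right.2 h2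
  rw [h3] at h4
  exact hc h4

theorem numCycles_sub_swap_mul_le {m : ℕ} {σ : Equiv.Perm (Fin m)} {W : Setoid (Fin m)}
    (hσ : permLePartition σ W) (a b : Fin m) :
    (numCycles (Equiv.swap a b * σ) : ℤ) - 2 * numBlocks (joinPair W a b)
      ≤ numCycles σ - 2 * numBlocks W + 1 := by
  have h1 := numBlocks_joinPair_le (cycleSetoid σ) a b
  have h2 := numBlocks_joinPair_le (cycleSetoid (Equiv.swap a b * σ)) a b
  rw [joinPair_cycleSetoid_swap_mul] at h2
  unfold numCycles
  by_cases hW : W a b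
  · rw [joinPair_eq_self hW]
    omega
  · have hc : ¬ cycleSetoid σ a b := fun h =>
      hW (Setoid.le_def.1 ((cycleSetoid_le_iff σ W).2 hσ) h)
    have h3 := numBlocks_joinPair hW
    have h4 := numBlocks_joinPair hc
    have h5 : joinPair (cycleSetoid (Equiv.swap a b * σ)) a b
        = cycleSetoid (Equiv.swap a b * σ) := joinPair_eq_self (sameCycle_swap_mul hc)
    rw [joinPair_cycleSetoid_swap_mul] at h5
    rw [← h5]
    omega

theorem exists_swap_mul {m : ℕ} {ρ : Equiv.Perm (Fin m)} (hρ : ρ ≠ 1) :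
    ∃ (a b : Fin m) (ρ' : Equiv.Perm (Fin m)), ρ = Equiv.swap a b * ρ' ∧
      numCycles ρ' = numCycles ρ + 1 ∧ cycleSetoid ρ = joinPair (cycleSetoid ρ') a b := by
  obtain ⟨a, ha⟩ : ∃ a, ρ a ≠ a := by
    by_contra! h
    exact hρ (Equiv.ext h)
  have hfix : (Equiv.swap a (ρ a) * ρ) a = a := by simp
  have hn : ¬ cycleSetoid (Equiv.swap a (ρ a) * ρ) a (ρ a) := by
    intro h
    obtain ⟨i, hi⟩ := h
    rw [Equiv.Perm.zpow_apply_eq_self_of_apply_eq_self hfix] at hi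
    exact ha hi.symm
  have hs : cycleSetoid ρ a (ρ a) := ⟨1, by simp⟩
  have hj := joinPair_cycleSetoid_swap_mul ρ a (ρ a)
  rw [joinPair_eq_self hs] at hj
  refine ⟨a, ρ a, Equiv.swap a (ρ a) * ρ, by simp, ?_, hj.symm⟩
  rw [numCycles, ← numBlocks_joinPair hn, hj, numCycles]

theorem numCycles_lt {m : ℕ} {ρ : Equiv.Perm (Fin m)} (hρ : ρ ≠ 1) : numCycles ρ < m := by
  obtain ⟨a, b, ρ', -, h, -⟩ := exists_swap_mul hρ
  have : numCycles ρ' ≤ m := numBlocks_le _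
  omega

theorem numCycles_one {m : ℕ} : numCycles (1 : Equiv.Perm (Fin m)) = m := by
  rw [numCycles, cycleSetoid_one, numBlocks_bot]

/-- The triangle inequality for lengths of partitioned permutations. -/
theorem numCycles_triangle {m : ℕ} (ρ σ : Equiv.Perm (Fin m)) (W : Setoid (Fin m))
    (hσ : permLePartition σ W) :
    (numCycles (ρ * σ) : ℤ) - 2 * numBlocks (W ⊔ cycleSetoid ρ)
      ≤ numCycles σ - 2 * numBlocks W + (m - numCycles ρ) := by
  obtain ⟨d, hd⟩ : ∃ d, m - numCycles ρ = d := ⟨_, rfl⟩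
  induction d generalizing ρ with
  | zero =>
    have hρ : ρ = 1 := by
      by_contra hρ
      have := numCycles_lt hρ
      omega
    subst hρ
    simp [cycleSetoid_one, numCycles_one]
  | succ d ih =>
    have hρ : ρ ≠ 1 := by
      rintro rfl
      rw [numCycles_one] at hd
      omega
    obtain ⟨a, b, ρ', rfl, hn, hj⟩ := exists_swap_mul hρ
    have h1 := ih ρ' (by omega)
    have hle : permLePartition (ρ' * σ) (W ⊔ cycleSetoid ρ') := fun x =>
      (W ⊔ cycleSetoid ρ').trans (Setoid.le_def.1 le_sup_left (hσ x))
        (Setoid.le_def.1 le_sup_right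
          (show cycleSetoid ρ' (σ x) (ρ' (σ x)) from ⟨1, by simp⟩))
    have h2 := numCycles_sub_swap_mul_le hle a b
    have h3 : joinPair (W ⊔ cycleSetoid ρ') a b = W ⊔ cycleSetoid (Equiv.swap a b * ρ') := by
      refine eq_of_forall_ge_iff fun S => ?_
      rw [hj, joinPair_le_iff, sup_le_iff, sup_le_iff, joinPair_le_iff, and_assoc]
    rw [h3] at h2
    rw [mul_assoc]
    omega

theorem card_comp_eq_comp {m n : ℕ} (γ σ : Equiv.Perm (Fin m)) :
    (Finset.univ.filter fun i : Fin m → Fin n => i ∘ γ = i ∘ σ).card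
      = n ^ numCycles (γ * σ⁻¹) := by
  rw [numCycles, numBlocks_eq_card_quotient, ← Fintype.card_subtype]
  have h : ∀ i : Fin m → Fin n, i ∘ γ = i ∘ σ ↔ cycleSetoid (γ * σ⁻¹) ≤ Setoid.ker i := by
    intro i
    rw [cycleSetoid_le_iff, funext_iff]
    constructor
    · intro hi x
      have : i (γ (σ⁻¹ x)) = i (σ (σ⁻¹ x)) := hi (σ⁻¹ x)
      rw [show σ (σ⁻¹ x) = x from σ.apply_symm_apply x] at this
      exact this.symm
    · intro hi x
      have : i (σ x) = i (γ (σ⁻¹ (σ x))) := hi (σ x)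
      rw [show σ⁻¹ (σ x) = x from σ.symm_apply_apply x] at this
      exact this.symm
  rw [Fintype.card_congr ((Equiv.subtypeEquivRight h).trans (Setoid.liftEquiv _))]
  simp

/-! ### Asymptotic invariance under conjugation -/

section Commutators

/-- The map identifying `i` and `i + 1`, a left inverse of `mergeEmb`. -/
def mergeMap (m i : ℕ) (hi : i + 1 < m) (t : Fin m) : Fin (m - 1) :=
  if h : (t : ℕ) ≤ i then ⟨t, by omega⟩ else ⟨t - 1, by omega⟩

theorem mergeMap_val {m i : ℕ} (hi : i + 1 < m) (t : Fin m) :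
    (mergeMap m i hi t : ℕ) = if (t : ℕ) ≤ i then (t : ℕ) else t - 1 := by
  unfold mergeMap
  split_ifs <;> rfl

theorem mergeEmb_val {m i : ℕ} (hi : i + 1 < m) (t : Fin (m - 1)) :
    (mergeEmb m i hi t : ℕ) = if (t : ℕ) ≤ i then (t : ℕ) else t + 1 := by
  unfold mergeEmb
  split_ifs <;> rfl

theorem mergeMap_mergeEmb {m i : ℕ} (hi : i + 1 < m) (t : Fin (m - 1)) :
    mergeMap m i hi (mergeEmb m i hi t) = t := by
  rw [Fin.ext_iff, mergeMap_val, mergeEmb_val]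
  split_ifs <;> omega

theorem mergeMap_monotone {m i : ℕ} (hi : i + 1 < m) : Monotone (mergeMap m i hi) := by
  intro x y hxy
  rw [Fin.le_def] at hxy ⊢
  rw [mergeMap_val, mergeMap_val]
  split_ifs <;> omega

theorem ker_mergeMap_le_iff {m i : ℕ} (hi : i + 1 < m) (S : Setoid (Fin m)) :
    Setoid.ker (mergeMap m i hi) ≤ S ↔ S ⟨i, by omega⟩ ⟨i + 1, hi⟩ := by
  constructor
  · refine fun h => Setoid.le_def.1 h (Fin.ext ?_)
    rw [mergeMap_val, mergeMap_val]
    simp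
  · intro h x y hxy
    have hxy' := Fin.ext_iff.1 (show mergeMap m i hi x = mergeMap m i hi y from hxy)
    rw [mergeMap_val, mergeMap_val] at hxy'
    have : x = y ∨ ((x : ℕ) = i ∧ (y : ℕ) = i + 1) ∨ ((x : ℕ) = i + 1 ∧ (y : ℕ) = i) := by
      rw [Fin.ext_iff]
      split_ifs at hxy' <;> omega
    rcases this with rfl | ⟨hx, hy⟩ | ⟨hx, hy⟩
    · exact S.refl x
    · subst hx
      obtain rfl : y = ⟨x + 1, hi⟩ := Fin.ext hy
      exact h
    · subst hy
      obtain rfl : x = ⟨y + 1, hi⟩ := Fin.ext hx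
      exact S.symm h

theorem comap_mergeMap_mergeSetoid {m i : ℕ} (hi : i + 1 < m) {V : Setoid (Fin m)}
    (hV : V ⟨i, by omega⟩ ⟨i + 1, hi⟩) :
    Setoid.comap (mergeMap m i hi) (mergeSetoid V i hi) = V := by
  have key : ∀ x, V (mergeEmb m i hi (mergeMap m i hi x)) x := fun x =>
    Setoid.le_def.1 ((ker_mergeMap_le_iff hi V).2 hV) (mergeMap_mergeEmb hi _)
  ext x y
  rw [Setoid.comap_rel]
  change V (mergeEmb m i hi (mergeMap m i hi x)) (mergeEmb m i hi (mergeMap m i hi y)) ↔ _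
  exact ⟨fun h => V.trans (V.symm (key x)) (V.trans h (key y)),
    fun h => V.trans (key x) (V.trans h (V.symm (key y)))⟩

theorem ordProd_mergeMap [Monoid A] {m i : ℕ} (hi : i + 1 < m) (a : Fin m → A) (j : Fin (m - 1)) :
    ordProd a (mergeMap m i hi ⁻¹' {j})
      = if (j : ℕ) = i then a ⟨i, by omega⟩ * a ⟨i + 1, hi⟩ else a (mergeEmb m i hi j) := by
  split_ifs with h
  · rw [ordProd_eq_of_pairwise a _ [⟨i, by omega⟩, ⟨i + 1, hi⟩]]
    · simp
    · simp
    · intro x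
      simp only [List.mem_cons, List.not_mem_nil, or_false, Set.mem_preimage,
        Set.mem_singleton_iff, Fin.ext_iff, mergeMap_val]
      split_ifs <;> omega
  · rw [ordProd_eq_of_pairwise a _ [mergeEmb m i hi j]]
    · simp
    · simp
    · intro x
      simp only [List.mem_cons, List.not_mem_nil, or_false, Set.mem_preimage,
        Set.mem_singleton_iff, Fin.ext_iff, mergeMap_val, mergeEmb_val]
      split_ifs <;> omega

theorem setoid_swap_apply {α : Type*} [DecidableEq α] (S : Setoid α) {a b : α} (h : S a b) (x : α) :
    S (Equiv.swap a b x) x := by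
  rw [Equiv.swap_apply_def]
  split_ifs with h1 h2
  · exact h1 ▸ S.symm h
  · exact h2 ▸ h
  · exact S.refl x

theorem comap_swap_eq_self {α : Type*} [DecidableEq α] {S : Setoid α} {a b : α} (h : S a b) :
    Setoid.comap (Equiv.swap a b).symm S = S := by
  ext x y
  rw [Setoid.comap_rel, Equiv.symm_swap]
  have key := setoid_swap_apply S h
  exact ⟨fun h => S.trans (S.symm (key x)) (S.trans h (key y)),
    fun h => S.trans (key x) (S.trans h (S.symm (key y)))⟩

theorem comap_symm_le_iff {α : Type*} (s : Equiv.Perm α) (V W : Setoid α) :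
    Setoid.comap s.symm V ≤ W ↔ V ≤ Setoid.comap s W := by
  constructor
  · intro h x y hxy
    rw [Setoid.comap_rel]
    refine Setoid.le_def.1 h ?_
    rwa [Setoid.comap_rel, s.symm_apply_apply, s.symm_apply_apply]
  · intro h x y hxy
    have := Setoid.le_def.1 h hxy
    rwa [Setoid.comap_rel, s.apply_symm_apply, s.apply_symm_apply] at this

theorem comap_swap_sup {α : Type*} [DecidableEq α] {K : Setoid α} {a b : α} (h : K a b) (W : Setoid α) :
    Setoid.comap (Equiv.swap a b).symm W ⊔ K = W ⊔ K := by
  refine eq_of_forall_ge_iff fun S => ?_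
  rw [sup_le_iff, sup_le_iff]
  refine and_congr_left fun hK => ?_
  rw [comap_symm_le_iff]
  have := comap_swap_eq_self (Setoid.le_def.1 hK h)
  rw [Equiv.symm_swap] at this
  rw [this]

theorem swap_lt_swap {m i : ℕ} (hi : i + 1 < m) {x y : Fin m} (hxy : x < y)
    (h : ¬ (x = ⟨i, by omega⟩ ∧ y = ⟨i + 1, hi⟩)) :
    Equiv.swap (⟨i, by omega⟩ : Fin m) ⟨i + 1, hi⟩ x
      < Equiv.swap (⟨i, by omega⟩ : Fin m) ⟨i + 1, hi⟩ y := by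
  rw [Equiv.swap_apply_def, Equiv.swap_apply_def]
  simp only [Fin.ext_iff] at h ⊢
  rw [Fin.lt_def] at hxy
  split_ifs <;> simp only [Fin.lt_def] <;> omega

theorem mergeSeq_eq_update [Ring A] {m i : ℕ} (hi : i + 1 < m) (a : Fin m → A) :
    mergeSeq a i hi = Function.update (fun j => ordProd a (mergeMap m i hi ⁻¹' {j}))
      ⟨i, by omega⟩ (a ⟨i, by omega⟩ * a ⟨i + 1, hi⟩ - a ⟨i + 1, hi⟩ * a ⟨i, by omega⟩) := by
  funext j
  unfold mergeSeq
  by_cases hj : (j : ℕ) = i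
  · rw [show j = ⟨i, by omega⟩ from Fin.ext hj, Function.update_self]
    simp
  · rw [Function.update_of_ne fun h => hj (Fin.ext_iff.1 h), ordProd_mergeMap, if_neg hj,
      if_neg hj]
    unfold mergeEmb
    split_ifs <;> first | rfl | omega

theorem ordProd_mergeMap_swap [Monoid A] {m i : ℕ} (hi : i + 1 < m) (a : Fin m → A) :
    (fun j => ordProd (a ∘ Equiv.swap (⟨i, by omega⟩ : Fin m) ⟨i + 1, hi⟩)
        (mergeMap m i hi ⁻¹' {j}))
      = Function.update (fun j => ordProd a (mergeMap m i hi ⁻¹' {j}))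
        ⟨i, by omega⟩ (a ⟨i + 1, hi⟩ * a ⟨i, by omega⟩) := by
  funext j
  rw [ordProd_mergeMap]
  by_cases hj : (j : ℕ) = i
  · rw [show j = ⟨i, by omega⟩ from Fin.ext hj, Function.update_self]
    simp
  · rw [Function.update_of_ne fun h => hj (Fin.ext_iff.1 h), ordProd_mergeMap, if_neg hj,
      if_neg hj, Function.comp_apply, Equiv.swap_apply_of_ne_of_ne]
    · rw [Ne, Fin.ext_iff, mergeEmb_val]
      split_ifs <;> simp only <;> omega
    · rw [Ne, Fin.ext_iff, mergeEmb_val]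
      split_ifs <;> simp only <;> omega

variable [Ring A] [Algebra ℂ A] {E : A →ₗ[ℂ] ℂ}
  {k : ∀ {l : ℕ}, Setoid (Fin l) → (Fin l → A) → ℂ}

theorem IsCumulant.comp_swap (hk : IsCumulant E k) {m i : ℕ} (hi : i + 1 < m)
    {V : Setoid (Fin m)} (hV : ¬ V ⟨i, by omega⟩ ⟨i + 1, hi⟩) (a : Fin m → A) :
    k V (a ∘ Equiv.swap ⟨i, by omega⟩ ⟨i + 1, hi⟩)
      = k (Setoid.comap (Equiv.swap (⟨i, by omega⟩ : Fin m) ⟨i + 1, hi⟩).symm V) a :=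
  hk.comp_perm V a _ fun _ _ hV' hxy => swap_lt_swap hi hxy fun h => hV (h.1 ▸ h.2 ▸ hV')

theorem IsCumulant.sub_comp_swap (hk : IsCumulant E k) {m i : ℕ} (hi : i + 1 < m)
    {V : Setoid (Fin m)} (hV : V ⟨i, by omega⟩ ⟨i + 1, hi⟩) (a : Fin m → A) :
    k V a - k V (a ∘ Equiv.swap ⟨i, by omega⟩ ⟨i + 1, hi⟩)
      = k (mergeSetoid V i hi) (mergeSeq a i hi) := by
  set s : Equiv.Perm (Fin m) := Equiv.swap ⟨i, by omega⟩ ⟨i + 1, hi⟩ with hs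
  have hprod := fun b : Fin m → A => hk.prod_formula (mergeMap m i hi) (mergeMap_monotone hi)
    (fun t => ⟨_, mergeMap_mergeEmb hi t⟩) b (mergeSetoid V i hi)
  rw [comap_mergeMap_mergeSetoid hi hV] at hprod
  obtain ⟨φ, hφ⟩ := hk.exists_linearMap_update (mergeSetoid V i hi)
    (fun j => ordProd a (mergeMap m i hi ⁻¹' {j})) ⟨i, by omega⟩
  have h1 : k (mergeSetoid V i hi) (mergeSeq a i hi)
      = k (mergeSetoid V i hi) (fun j => ordProd a (mergeMap m i hi ⁻¹' {j}))
        - k (mergeSetoid V i hi) (fun j => ordProd (a ∘ s) (mergeMap m i hi ⁻¹' {j})) := by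
    rw [mergeSeq_eq_update, ordProd_mergeMap_swap, hφ, hφ, map_sub, ← hφ (_ * _)]
    congr 2
    exact Function.update_eq_iff.2 ⟨by rw [ordProd_mergeMap, if_pos rfl], fun _ _ => rfl⟩
  have hker : Setoid.ker (mergeMap m i hi) ⟨i, by omega⟩ ⟨i + 1, hi⟩ :=
    (ker_mergeMap_le_iff hi _).1 le_rfl
  have hVV : V ⊔ Setoid.ker (mergeMap m i hi) = V :=
    sup_eq_left.2 ((ker_mergeMap_le_iff hi V).2 hV)
  have hmem : V ∈ Finset.univ.filter
      (fun W : Setoid (Fin m) => W ⊔ Setoid.ker (mergeMap m i hi) = V) := by simp [hVV]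
  have hsV : Setoid.comap s.symm V = V := comap_swap_eq_self hV
  have hss : ∀ W : Setoid (Fin m), Setoid.comap s.symm (Setoid.comap s.symm W) = W := by
    intro W
    ext x y
    simp [Setoid.comap_rel, hs]
  rw [h1, hprod, hprod, ← Finset.add_sum_erase _ _ hmem, ← Finset.add_sum_erase _ _ hmem]
  have h2 : ∑ W ∈ (Finset.univ.filter
        (fun W : Setoid (Fin m) => W ⊔ Setoid.ker (mergeMap m i hi) = V)).erase V, k W (a ∘ s)
      = ∑ W ∈ (Finset.univ.filter
        (fun W : Setoid (Fin m) => W ⊔ Setoid.ker (mergeMap m i hi) = V)).erase V, k W a := by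
    have hmaps : ∀ W ∈ (Finset.univ.filter
        (fun W : Setoid (Fin m) => W ⊔ Setoid.ker (mergeMap m i hi) = V)).erase V,
        Setoid.comap s.symm W ∈ (Finset.univ.filter
          (fun W : Setoid (Fin m) => W ⊔ Setoid.ker (mergeMap m i hi) = V)).erase V := by
      intro W hW
      simp only [Finset.mem_erase, Finset.mem_filter, Finset.mem_univ, true_and] at hW ⊢
      refine ⟨fun h => hW.1 ?_, (comap_swap_sup hker W).trans hW.2⟩
      rw [← hss W, h, hsV]
    refine Finset.sum_nbij' (Setoid.comap s.symm) (Setoid.comap s.symm) hmaps hmaps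
      (fun W _ => hss W) (fun W _ => hss W) fun W hW => ?_
    simp only [Finset.mem_erase, Finset.mem_filter, Finset.mem_univ, true_and] at hW
    refine hk.comp_swap hi (fun h => hW.1 ?_) a
    rw [← hW.2, sup_eq_left.2 ((ker_mergeMap_le_iff hi W).2 h)]
  rw [h2]
  ring

theorem permLePartition_conj {m : ℕ} {V : Setoid (Fin m)} {π : Equiv.Perm (Fin m)}
    (h : permLePartition π V) (s : Equiv.Perm (Fin m)) :
    permLePartition (s * π * s⁻¹) (Setoid.comap s.symm V) := by
  intro x
  change V (s.symm x) (s.symm (s (π (s.symm x))))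
  rw [s.symm_apply_apply]
  exact h _

theorem IsCumulant.kappa_conj_swap {n : ℕ} (hk : IsCumulant E k) {X : Matrix (Fin n) (Fin n) A}
    (hX : UnitarilyInvariant E X) {m i : ℕ} (h : m ≤ n) (hi : i + 1 < m) (V : Setoid (Fin m))
    (π : Equiv.Perm (Fin m)) {s : Equiv.Perm (Fin m)}
    (hs : s = Equiv.swap ⟨i, by omega⟩ ⟨i + 1, hi⟩) :
    kappa k X h (Setoid.comap s.symm V) (s * π * s⁻¹) - kappa k X h V π
      = if V ⟨i, by omega⟩ ⟨i + 1, hi⟩ then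
          k (mergeSetoid V i hi) (mergeSeq
            (fun t => X (Fin.castLE h t) (Fin.castLE h ((s * π * s⁻¹) t))) i hi)
        else 0 := by
  have hcomp : kappa k X h V π
      = k V ((fun t => X (Fin.castLE h t) (Fin.castLE h ((s * π * s⁻¹) t))) ∘ s) := by
    rw [← hk.kappa_of_injective hX h V π ((Fin.castLE_injective h).comp s.injective)]
    simp [Function.comp_def]
  rw [hcomp]
  split_ifs with hV
  · rw [← hk.sub_comp_swap hi hV, ← hs, show Setoid.comap s.symm V = V from
      hs ▸ comap_swap_eq_self hV]
    rfl
  · rw [sub_eq_zero, hs, hk.comp_swap hi hV]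
    rfl

end Commutators

section Asymptotics

theorem kappaSeq_of_le {A : ℕ → Type*} {k : ∀ n, ∀ {l : ℕ}, Setoid (Fin l) → (Fin l → A n) → ℂ}
    {X : ∀ n, Matrix (Fin n) (Fin n) (A n)} {m n : ℕ} (h : m ≤ n) (V : Setoid (Fin m)) (π : Equiv.Perm (Fin m)) :
    kappaSeq k X V π n = kappa (k n) (X n) h V π := dif_pos h

variable {A : ℕ → Type*} [∀ n, Ring (A n)] [∀ n, Algebra ℂ (A n)]
  {E : ∀ n, A n →ₗ[ℂ] ℂ} {k : ∀ n, ∀ {l : ℕ}, Setoid (Fin l) → (Fin l → A n) → ℂ}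
  {X : ∀ n, Matrix (Fin n) (Fin n) (A n)} {m₀ m : ℕ}

theorem tendsto_conj_sub (hk : ∀ n, IsCumulant (E n) (@k n))
    (hX : ∀ n, UnitarilyInvariant (E n) (X n)) (hcomm : AsympVanishingComm (fun n => @k n) X m₀)
    (hm : m ≤ m₀) (s : Equiv.Perm (Fin m)) (V : Setoid (Fin m)) (π : Equiv.Perm (Fin m))
    (hπ : permLePartition π V) :
    Tendsto (fun n : ℕ => (n : ℂ) ^ ppLen V π *
      (kappaSeq (fun n => @k n) X (Setoid.comap s.symm V) (s * π * s⁻¹) n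
        - kappaSeq (fun n => @k n) X V π n)) atTop (nhds 0) := by
  induction m with
  | zero =>
    have h1 : Setoid.comap s.symm V = V := Setoid.ext fun x => x.elim0
    simp [h1, Subsingleton.elim (s * π * s⁻¹) π]
  | succ m _ =>
  have hs : s ∈ Submonoid.closure (Set.range fun i : Fin m => Equiv.swap i.castSucc i.succ) := by
    rw [Equiv.Perm.mclosure_swap_castSucc_succ]
    trivial
  induction hs using Submonoid.closure_induction generalizing V π with
  | mem s hs =>
    obtain ⟨i, hs⟩ := hs
    have hi : (i : ℕ) + 1 < m + 1 := by omega
    replace hs : s = Equiv.swap ⟨i, by omega⟩ ⟨i + 1, hi⟩ := hs.symm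
    by_cases hV : V ⟨i, by omega⟩ ⟨i + 1, hi⟩
    · have hsV : Setoid.comap s.symm V = V := hs ▸ comap_swap_eq_self hV
      have hlim := hcomm (m + 1) hm V (s * π * s⁻¹) (hsV ▸ permLePartition_conj hπ s) i hi hV
      refine hlim.congr' ?_
      filter_upwards [eventually_ge_atTop (m + 1)] with n hn
      rw [dif_pos hn, kappaSeq_of_le hn, kappaSeq_of_le hn,
        (hk n).kappa_conj_swap (hX n) hn hi V π hs, if_pos hV]
      conv_lhs => rw [← hsV, ppLen_conj]
      rw [hsV]
    · refine tendsto_const_nhds.congr' ?_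
      filter_upwards [eventually_ge_atTop (m + 1)] with n hn
      rw [kappaSeq_of_le hn, kappaSeq_of_le hn,
        (hk n).kappa_conj_swap (hX n) hn hi V π hs, if_neg hV, mul_zero]
  | one =>
    have : Setoid.comap (1 : Equiv.Perm (Fin (m + 1))).symm V = V := rfl
    simp [this]
  | mul s t _ _ ihs iht =>
    have h := (ihs (Setoid.comap t.symm V) (t * π * t⁻¹) (permLePartition_conj hπ t)).add
      (iht V π hπ)
    rw [add_zero] at h
    refine h.congr fun n => ?_
    rw [ppLen_conj, ← mul_add, sub_add_sub_cancel,
      show s * (t * π * t⁻¹) * s⁻¹ = s * t * π * (s * t)⁻¹ by group]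
    rfl

end Asymptotics

/-! ### Cumulants of traces of powers -/

theorem pow_succ_apply [Semiring A] {n : ℕ} (X : Matrix (Fin n) (Fin n) A) (p : ℕ) (a b : Fin n) :
    (X ^ (p + 1)) a b = ∑ c : Fin p → Fin n, (List.ofFn fun s : Fin (p + 1) =>
      X (Fin.cons (α := fun _ => Fin n) a c s) (Fin.snoc (α := fun _ => Fin n) c b s)).prod := by
  induction p generalizing a with
  | zero => simp [Fin.snoc]
  | succ p ih =>
    rw [pow_succ', Matrix.mul_apply,
      ← (Fin.consEquiv fun _ : Fin (p + 1) => Fin n).sum_comp, Fintype.sum_prod_type]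
    refine Finset.sum_congr rfl fun d _ => ?_
    rw [ih, Finset.mul_sum]
    refine Finset.sum_congr rfl fun c _ => ?_
    rw [List.ofFn_succ (n := p + 1), List.prod_cons]
    change _ = X a (Fin.snoc (α := fun _ => Fin n) (Fin.cons (α := fun _ => Fin n) d c) b 0)
      * (List.ofFn fun s : Fin (p + 1) => X (Fin.cons (α := fun _ => Fin n) d c s)
        (Fin.snoc (α := fun _ => Fin n) (Fin.cons (α := fun _ => Fin n) d c) b s.succ)).prod
    simp only [← Fin.cons_snoc_eq_snoc_cons, Fin.cons_zero, Fin.cons_succ]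

theorem trace_pow [Semiring A] {n : ℕ} (X : Matrix (Fin n) (Fin n) A) {p : ℕ} (hp : 1 ≤ p) :
    Matrix.trace (X ^ p) = ∑ c : Fin p → Fin n,
      (List.ofFn fun s : Fin p => X (c s) (c (finRotate p s))).prod := by
  obtain ⟨p, rfl⟩ := Nat.exists_eq_add_of_le' hp
  rw [Matrix.trace, ← (Fin.consEquiv fun _ : Fin (p + 1) => Fin n).sum_comp,
    Fintype.sum_prod_type]
  refine Finset.sum_congr rfl fun a _ => ?_
  rw [Matrix.diag_apply, pow_succ_apply]
  refine Finset.sum_congr rfl fun c _ => ?_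
  rw [Fin.snoc_eq_cons_rotate]
  rfl

theorem val_finRotate {p : ℕ} (s : Fin p) : (finRotate p s : ℕ) = (s + 1) % p := by
  obtain _ | p := p
  · exact s.elim0
  · rw [finRotate_apply, Fin.val_add_one]
    split_ifs with h
    · simp [h]
    · have := Fin.val_lt_last h
      rw [Nat.mod_eq_of_lt (by omega)]

theorem setoid_of_finRotate {β : Type*} (S : Setoid β) {p : ℕ} (f : Fin p → β)
    (h : ∀ s, S (f s) (f (finRotate p s))) (s t : Fin p) : S (f s) (f t) := by
  obtain _ | p := p
  · exact s.elim0
  · have key : ∀ s, S (f 0) (f s) := by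
      intro s
      induction s using Fin.induction with
      | zero => exact S.refl _
      | succ s ih =>
        have := h s.castSucc
        rw [finRotate_apply, Fin.coeSucc_eq_succ] at this
        exact S.trans ih this
    exact S.trans (S.symm (key s)) (key t)

/-- `γ` permutes cyclically the consecutive blocks of lengths `p j`, as described by the
lexicographic enumeration `e`. -/
def IsBlockPerm {l m : ℕ} {p : Fin l → ℕ} (e : (Σₗ j, Fin (p j)) ≃o Fin m)
    (γ : Equiv.Perm (Fin m)) : Prop :=
  ∀ j s, γ (e (toLex ⟨j, s⟩)) = e (toLex ⟨j, finRotate (p j) s⟩)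

/-- The index of the block containing a given element. -/
def blockIndex {l m : ℕ} {p : Fin l → ℕ} (e : (Σₗ j, Fin (p j)) ≃o Fin m) (t : Fin m) : Fin l :=
  (ofLex (e.symm t)).1

section Blocks

variable {l m : ℕ} {p : Fin l → ℕ} {e : (Σₗ j, Fin (p j)) ≃o Fin m} {γ : Equiv.Perm (Fin m)}

theorem blockIndex_apply (x : Σ j, Fin (p j)) : blockIndex e (e (toLex x)) = x.1 := by
  simp [blockIndex]

theorem blockIndex_monotone : Monotone (blockIndex e) := by
  intro x y hxy
  have := e.symm.monotone hxy
  rw [Sigma.Lex.le_def] at this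
  rcases this with h | ⟨h, -⟩
  exacts [h.le, h.le]

theorem blockIndex_surjective (hp : ∀ j, 1 ≤ p j) : Function.Surjective (blockIndex e) :=
  fun j => ⟨e (toLex ⟨j, ⟨0, hp j⟩⟩), blockIndex_apply _⟩

theorem IsBlockPerm.ker_blockIndex (hγ : IsBlockPerm e γ) :
    Setoid.ker (blockIndex e) = cycleSetoid γ := by
  refine le_antisymm ?_ ((cycleSetoid_le_iff _ _).2 ?_)
  · intro x y hxy
    obtain ⟨⟨j, s⟩, rfl⟩ := (toLex.trans e.toEquiv).surjective x
    obtain ⟨⟨j', s'⟩, rfl⟩ := (toLex.trans e.toEquiv).surjective y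
    obtain rfl : j = j' := by simpa [Setoid.ker_def, blockIndex] using hxy
    refine setoid_of_finRotate (cycleSetoid γ) (fun s => e (toLex ⟨j, s⟩)) (fun s => ?_) s s'
    rw [← hγ]
    exact ⟨1, by simp⟩
  · intro x
    obtain ⟨⟨j, s⟩, rfl⟩ := (toLex.trans e.toEquiv).surjective x
    change blockIndex e (e (toLex ⟨j, s⟩)) = blockIndex e (γ (e (toLex ⟨j, s⟩)))
    rw [hγ, blockIndex_apply, blockIndex_apply]

theorem IsBlockPerm.numCycles_eq (hγ : IsBlockPerm e γ) (hp : ∀ j, 1 ≤ p j) : numCycles γ = l := by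
  rw [numCycles, ← hγ.ker_blockIndex, numBlocks_eq_card _ (blockIndex e) (blockIndex_surjective hp)
    fun s t => Iff.rfl, Fintype.card_fin]

theorem ordProd_blockIndex [Monoid A] (a : Fin m → A) (j : Fin l) :
    ordProd a (blockIndex e ⁻¹' {j}) = (List.ofFn fun s => a (e (toLex ⟨j, s⟩))).prod := by
  rw [ordProd_eq_of_pairwise a _ (List.ofFn fun s => e (toLex ⟨j, s⟩)), List.map_ofFn]
  · rfl
  · rw [List.pairwise_ofFn]
    intro s t hst
    refine e.strictMono ?_
    rw [Sigma.Lex.lt_def]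
    exact Or.inr ⟨rfl, hst⟩
  · intro x
    rw [List.mem_ofFn', Set.mem_range, Set.mem_preimage, Set.mem_singleton_iff]
    constructor
    · rintro ⟨s, rfl⟩
      exact blockIndex_apply _
    · rintro rfl
      exact ⟨(ofLex (e.symm x)).2, by simp [blockIndex]⟩

variable [Ring A] [Algebra ℂ A] {E : A →ₗ[ℂ] ℂ}
  {k : ∀ {l : ℕ}, Setoid (Fin l) → (Fin l → A) → ℂ} {n : ℕ} {X : Matrix (Fin n) (Fin n) A}

theorem IsCumulant.traces_eq_sum_entries (hk : IsCumulant E k) (hp : ∀ j, 1 ≤ p j)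
    (hγ : IsBlockPerm e γ) (U : Setoid (Fin l)) :
    k U (fun j => ncTrace (X ^ p j))
      = ((n : ℂ)⁻¹) ^ l * ∑ c : Fin m → Fin n,
        k U (fun j => ordProd (fun t => X (c t) (c (γ t))) (blockIndex e ⁻¹' {j})) := by
  have h := hk.map_sum_smul U (ι := fun j => Fin (p j) → Fin n) (fun _ _ => (n : ℂ)⁻¹)
    (fun j c => (List.ofFn fun s : Fin (p j) => X (c s) (c (finRotate (p j) s))).prod)
  simp only [← Finset.smul_sum, ← trace_pow X (hp _)] at h
  refine h.trans ?_
  rw [Finset.mul_sum, ← (((toLex.trans e.toEquiv).arrowCongr (Equiv.refl (Fin n))).symm.trans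
    (Equiv.piCurry fun _ _ => Fin n)).sum_comp]
  refine Finset.sum_congr rfl fun c _ => ?_
  rw [Finset.prod_const, Finset.card_univ, Fintype.card_fin]
  congr 2
  funext j
  rw [ordProd_blockIndex]
  simp only [hγ j]
  rfl

theorem IsCumulant.traces_eq_sum (hk : IsCumulant E k) (hX : UnitarilyInvariant E X)
    (h : m ≤ n) (hp : ∀ j, 1 ≤ p j) (hγ : IsBlockPerm e γ) :
    k ⊤ (fun j => ncTrace (X ^ p j))
      = ((n : ℂ)⁻¹) ^ numCycles γ *
        ∑ W ∈ Finset.univ.filter (fun W : Setoid (Fin m) => W ⊔ cycleSetoid γ = ⊤),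
          ∑ σ : Equiv.Perm (Fin m), (n : ℂ) ^ numCycles (γ * σ⁻¹) * kappa k X h W σ := by
  have htop : Setoid.comap (blockIndex e) (⊤ : Setoid (Fin l)) = ⊤ := Setoid.ext fun _ _ => Iff.rfl
  rw [hk.traces_eq_sum_entries hp hγ, hγ.numCycles_eq hp]
  congr 1
  simp only [hk.prod_formula (blockIndex e) blockIndex_monotone (blockIndex_surjective hp), htop,
    hγ.ker_blockIndex]
  rw [Finset.sum_comm]
  refine Finset.sum_congr rfl fun W _ => ?_
  have hW : ∀ c : Fin m → Fin n, k W (fun t => X (c t) (c (γ t)))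
      = ∑ σ : Equiv.Perm (Fin m), if c ∘ γ = c ∘ σ then kappa k X h W σ else 0 :=
    fun c => hk.entries_eq_sum hX h W c (c ∘ γ)
  simp only [hW]
  rw [Finset.sum_comm]
  refine Finset.sum_congr rfl fun σ _ => ?_
  rw [← Finset.sum_filter, Finset.sum_const, card_comp_eq_comp, nsmul_eq_mul, Nat.cast_pow]

end Blocks

theorem exists_isBlockPerm_conj {m : ℕ} (π : Equiv.Perm (Fin m)) :
    ∃ (l : ℕ) (p : Fin l → ℕ) (e : (Σₗ j, Fin (p j)) ≃o Fin m) (s : Equiv.Perm (Fin m)),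
      (∀ j, 1 ≤ p j) ∧ ∑ j, p j = m ∧ IsBlockPerm e (s * π * s⁻¹) := by
  set l := Fintype.card (Quotient (cycleSetoid π)) with hl
  let r : Fin l → Fin m := fun j => ((Fintype.equivFin (Quotient (cycleSetoid π))).symm j).out
  have hr : ∀ i j, cycleSetoid π (r i) (r j) → i = j := by
    intro i j hij
    have := Quotient.sound hij
    simpa [r] using this
  have hr' : ∀ x, ∃ j, cycleSetoid π (r j) x := by
    intro x
    refine ⟨Fintype.equivFin _ (Quotient.mk _ x), ?_⟩
    simp only [r, Equiv.symm_apply_apply]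
    exact Quotient.mk_out (s := cycleSetoid π) x
  have hper : ∀ x, x ∈ Function.periodicPts π := fun x =>
    π.injective.mem_periodicPts x
  let p : Fin l → ℕ := fun j => Function.minimalPeriod π (r j)
  have hp : ∀ j, 1 ≤ p j := fun j => Function.minimalPeriod_pos_of_mem_periodicPts (hper _)
  let f : (Σ j, Fin (p j)) → Fin m := fun x => π^[x.2] (r x.1)
  have hsame : ∀ (i : ℕ) x, cycleSetoid π x (π^[i] x) := fun i x =>
    ⟨i, by rw [zpow_natCast, Equiv.Perm.coe_pow]⟩
  have hf : Function.Bijective f := by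
    constructor
    · rintro ⟨i, s⟩ ⟨j, t⟩ h
      change π^[s] (r i) = π^[t] (r j) at h
      obtain rfl : i = j := hr i j <| (cycleSetoid π).trans (hsame s (r i))
        (h ▸ (cycleSetoid π).symm (hsame t (r j)))
      rw [Fin.ext (Function.iterate_injOn_Iio_minimalPeriod s.2 t.2 h)]
    · intro x
      obtain ⟨j, hj⟩ := hr' x
      obtain ⟨i, hi⟩ := Equiv.Perm.SameCycle.exists_nat_pow_eq hj
      refine ⟨⟨j, i % p j, Nat.mod_lt _ (hp j)⟩, ?_⟩
      change π^[i % p j] (r j) = x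
      rw [Function.iterate_mod_minimalPeriod_eq, ← Equiv.Perm.coe_pow, hi]
  have hcard : Fintype.card (Σₗ j, Fin (p j)) = m := by
    rw [Fintype.card_congr (ofLex.trans (Equiv.ofBijective f hf)), Fintype.card_fin]
  let e : (Σₗ j, Fin (p j)) ≃o Fin m := (Fintype.orderIsoFinOfCardEq _ hcard).symm
  refine ⟨l, p, e, (Equiv.ofBijective f hf).symm.trans (toLex.trans e.toEquiv), hp, ?_, ?_⟩
  · have := Fintype.card_congr (Equiv.ofBijective f hf)
    simpa using this
  · intro j s
    have hrot : π (f ⟨j, s⟩) = f ⟨j, finRotate (p j) s⟩ := by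
      change π (π^[s] (r j)) = π^[finRotate (p j) s] (r j)
      rw [val_finRotate, Function.iterate_mod_minimalPeriod_eq, Function.iterate_succ_apply']
    have h1 : ((Equiv.ofBijective f hf).symm.trans (toLex.trans e.toEquiv))⁻¹ (e (toLex ⟨j, s⟩))
        = f ⟨j, s⟩ := by
      rw [Equiv.Perm.inv_eq_iff_eq]
      simp
    rw [Equiv.Perm.mul_apply, Equiv.Perm.mul_apply, h1, hrot]
    change e (toLex ((Equiv.ofBijective f hf).symm (f ⟨j, finRotate (p j) s⟩))) = _
    rw [Equiv.ofBijective_symm_apply_apply]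

/-! ### Partitioned permutations with several blocks -/

theorem comap_cycleSetoid_of_semiconj {m m₁ : ℕ} {π : Equiv.Perm (Fin m)}
    {π₁ : Equiv.Perm (Fin m₁)} {g : Fin m₁ → Fin m} (hg : Function.Injective g)
    (h : Function.Semiconj g π₁ π) : Setoid.comap g (cycleSetoid π) = cycleSetoid π₁ := by
  have key : ∀ (i : ℕ) x, g ((π₁ ^ i) x) = (π ^ i) (g x) := fun i x => by
    rw [Equiv.Perm.coe_pow, Equiv.Perm.coe_pow]
    exact h.iterate_right i x
  ext x y
  rw [Setoid.comap_rel, cycleSetoid_rel, cycleSetoid_rel]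
  constructor <;> intro hxy
  · obtain ⟨i, hi⟩ := hxy.exists_nat_pow_eq
    exact ⟨i, hg (by rw [zpow_natCast, key, hi])⟩
  · obtain ⟨i, hi⟩ := hxy.exists_nat_pow_eq
    exact ⟨i, by rw [zpow_natCast, ← key, hi]⟩

theorem exists_splitting {m : ℕ} {V : Setoid (Fin m)} {π : Equiv.Perm (Fin m)}
    (hV : V ≠ ⊤) (hπ : permLePartition π V) :
    ∃ (m₁ m₂ : ℕ) (e : Fin m₁ ⊕ Fin m₂ ≃ Fin m) (π₁ : Equiv.Perm (Fin m₁))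
      (π₂ : Equiv.Perm (Fin m₂)), m₁ < m ∧ m₂ < m ∧
      StrictMono (e ∘ Sum.inl) ∧ StrictMono (e ∘ Sum.inr) ∧
      (∀ x y, ¬ V (e (Sum.inl x)) (e (Sum.inr y))) ∧
      Function.Semiconj (e ∘ Sum.inl) π₁ π ∧ Function.Semiconj (e ∘ Sum.inr) π₂ π := by
  obtain ⟨x₀, y₀, h₀⟩ : ∃ x y, ¬ V x y := by
    by_contra! h
    exact hV (Setoid.ext fun x y => iff_of_true (h x y) trivial)
  set S : Finset (Fin m) := Finset.univ.filter fun t => V x₀ t with hS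
  have hx : x₀ ∈ S := by simp [hS]
  have hy : y₀ ∈ Sᶜ := by simp [hS, h₀]
  let e : Fin S.card ⊕ Fin Sᶜ.card ≃ Fin m := finSumEquivOfFinset rfl rfl
  have hl : ∀ x, V x₀ (e (Sum.inl x)) := fun x => by
    have hmem : e (Sum.inl x) ∈ S := by
      change finSumEquivOfFinset rfl rfl (Sum.inl x) ∈ S
      rw [finSumEquivOfFinset_inl]
      exact Finset.orderEmbOfFin_mem S rfl x
    exact (Finset.mem_filter.1 hmem).2
  have hr : ∀ x, ¬ V x₀ (e (Sum.inr x)) := fun x h => by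
    have hmem : e (Sum.inr x) ∈ Sᶜ := by
      change finSumEquivOfFinset rfl rfl (Sum.inr x) ∈ Sᶜ
      rw [finSumEquivOfFinset_inr]
      exact Finset.orderEmbOfFin_mem Sᶜ rfl x
    exact Finset.mem_compl.1 hmem (Finset.mem_filter.2 ⟨Finset.mem_univ _, h⟩)
  have hmaps : Set.MapsTo (e.permCongr.symm π) (Set.range Sum.inl) (Set.range Sum.inl) := by
    rintro _ ⟨x, rfl⟩
    obtain ⟨z | z, hz⟩ := e.surjective (π (e (Sum.inl x)))
    · exact ⟨z, by simp [Equiv.permCongr_symm, Equiv.permCongr_apply, ← hz]⟩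
    · exact absurd (hz ▸ V.trans (hl x) (hπ _)) (hr z)
  obtain ⟨⟨π₁, π₂⟩, hππ⟩ := Equiv.Perm.mem_sumCongrHom_range_of_perm_mapsTo_inl hmaps
  have hc : ∀ z, e (Equiv.sumCongr π₁ π₂ z) = π (e z) := by
    intro z
    have := Equiv.congr_fun hππ z
    change Equiv.sumCongr π₁ π₂ z = e.symm (π (e z)) at this
    rw [this, e.apply_symm_apply]
  refine ⟨_, _, e, π₁, π₂, ?_, ?_, ?_, ?_, ?_, fun x => hc (Sum.inl x), fun x => hc (Sum.inr x)⟩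
  · exact (Finset.card_lt_univ_of_notMem (Finset.mem_compl.1 hy)).trans_eq (Fintype.card_fin m)
  · exact (Finset.card_lt_univ_of_notMem (fun h => Finset.mem_compl.1 h hx)).trans_eq
      (Fintype.card_fin m)
  · intro x y hxy
    simpa [e] using hxy
  · intro x y hxy
    simpa [e] using hxy
  · exact fun x y h => hr y (V.trans (hl x) h)

theorem permLePartition_of_semiconj {m m₁ : ℕ} {V : Setoid (Fin m)} {π : Equiv.Perm (Fin m)}
    {π₁ : Equiv.Perm (Fin m₁)} {g : Fin m₁ → Fin m} (h : Function.Semiconj g π₁ π)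
    (hπ : permLePartition π V) : permLePartition π₁ (Setoid.comap g V) := by
  intro x
  change V (g x) (g (π₁ x))
  rw [h x]
  exact hπ _

theorem exists_tendsto_of_ne_top {A : ℕ → Type*} [∀ n, Ring (A n)] [∀ n, Algebra ℂ (A n)]
    {E : ∀ n, A n →ₗ[ℂ] ℂ} {k : ∀ n, ∀ {l : ℕ}, Setoid (Fin l) → (Fin l → A n) → ℂ}
    {X : ∀ n, Matrix (Fin n) (Fin n) (A n)} {m : ℕ}
    (hk : ∀ n, IsCumulant (E n) (@k n)) (hX : ∀ n, UnitarilyInvariant (E n) (X n))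
    (hK : ∀ m' < m, ∀ (V : Setoid (Fin m')) (π : Equiv.Perm (Fin m')),
      permLePartition π V → ∃ K : ℂ,
        Tendsto (fun n : ℕ => (n : ℂ) ^ (ppLen V π) * kappaSeq (fun n => @k n) X V π n)
          atTop (nhds K))
    {V : Setoid (Fin m)} {π : Equiv.Perm (Fin m)} (hV : V ≠ ⊤) (hπ : permLePartition π V) :
    ∃ K : ℂ, Tendsto (fun n : ℕ => (n : ℂ) ^ (ppLen V π) * kappaSeq (fun n => @k n) X V π n)
      atTop (nhds K) := by
  obtain ⟨m₁, m₂, e, π₁, π₂, hm₁, hm₂, he₁, he₂, hd, hc₁, hc₂⟩ := exists_splitting hV hπ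
  obtain ⟨K₁, hK₁⟩ := hK m₁ hm₁ _ π₁ (permLePartition_of_semiconj hc₁ hπ)
  obtain ⟨K₂, hK₂⟩ := hK m₂ hm₂ _ π₂ (permLePartition_of_semiconj hc₂ hπ)
  refine ⟨K₁ * K₂, (hK₁.mul hK₂).congr' ?_⟩
  have hlen : ppLen V π = ppLen (Setoid.comap (e ∘ Sum.inl) V) π₁
      + ppLen (Setoid.comap (e ∘ Sum.inr) V) π₂ := by
    have hm : (m₁ + m₂ : ℤ) = m := by
      exact_mod_cast (by simpa using Fintype.card_congr e : m₁ + m₂ = m)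
    have hcyc := numBlocks_sum (cycleSetoid π) e fun x y h =>
      hd x y (Setoid.le_def.1 ((cycleSetoid_le_iff π V).2 hπ) h)
    rw [comap_cycleSetoid_of_semiconj he₁.injective hc₁,
      comap_cycleSetoid_of_semiconj he₂.injective hc₂] at hcyc
    unfold ppLen numCycles
    rw [hcyc, numBlocks_sum V e hd]
    push_cast
    linarith
  filter_upwards [eventually_ge_atTop m, eventually_ne_atTop 0] with n hn hn0
  have hn1 : m₁ ≤ n := by omega
  have hn2 : m₂ ≤ n := by omega
  rw [kappaSeq_of_le hn, kappaSeq_of_le hn1, kappaSeq_of_le hn2, hlen,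
    zpow_add₀ (Nat.cast_ne_zero.2 hn0)]
  have hsplit : kappa (k n) (X n) hn V π
      = kappa (k n) (X n) hn1 (Setoid.comap (e ∘ Sum.inl) V) π₁
        * kappa (k n) (X n) hn2 (Setoid.comap (e ∘ Sum.inr) V) π₂ := by
    rw [← (hk n).kappa_of_injective (hX n) hn1 _ π₁
      ((Fin.castLE_injective hn).comp he₁.injective),
      ← (hk n).kappa_of_injective (hX n) hn2 _ π₂
      ((Fin.castLE_injective hn).comp he₂.injective)]
    refine ((hk n).mul_of_splitting V _ e he₁ he₂ hd).trans ?_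
    simp only [Function.comp_def]
    have h1 : ∀ x, π (e (Sum.inl x)) = e (Sum.inl (π₁ x)) := fun x => (hc₁ x).symm
    have h2 : ∀ x, π (e (Sum.inr x)) = e (Sum.inr (π₂ x)) := fun x => (hc₂ x).symm
    simp only [h1, h2]
  rw [hsplit]
  ring

/-! ### Inverting the relation between traces and cumulants -/

theorem tendsto_natCast_zpow {e : ℤ} (he : e ≤ 0) :
    Tendsto (fun n : ℕ => (n : ℂ) ^ e) atTop (nhds (if e = 0 then 1 else 0)) := by
  obtain ⟨j, rfl⟩ : ∃ j : ℕ, e = -j := ⟨e.natAbs, by omega⟩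
  rcases Nat.eq_zero_or_pos j with rfl | hj
  · simp
  · have h := (tendsto_inv_atTop_nhds_zero_nat (𝕜 := ℂ)).pow j
    rw [zero_pow hj.ne'] at h
    rw [if_neg (by omega)]
    simpa [zpow_neg] using h

theorem tendsto_mulVec {ι : Type*} [Fintype ι] {M : ℕ → Matrix ι ι ℂ} {M₀ : Matrix ι ι ℂ}
    {v : ℕ → ι → ℂ} {v₀ : ι → ℂ} (hM : Tendsto M atTop (nhds M₀))
    (hv : Tendsto v atTop (nhds v₀)) :
    Tendsto (fun n => (M n).mulVec (v n)) atTop (nhds (M₀.mulVec v₀)) :=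
  tendsto_pi_nhds.2 fun i => tendsto_finsetSum _ fun j _ =>
    (tendsto_pi_nhds.1 (tendsto_pi_nhds.1 hM i) j).mul (tendsto_pi_nhds.1 hv j)

theorem exists_tendsto_of_mulVec {ι : Type*} [Fintype ι] [DecidableEq ι] {M : ℕ → Matrix ι ι ℂ}
    {M₀ : Matrix ι ι ℂ} {x : ℕ → ι → ℂ} {b : ι → ℂ} (hM : Tendsto M atTop (nhds M₀))
    (hdet : M₀.det ≠ 0) (hb : Tendsto (fun n => (M n).mulVec (x n)) atTop (nhds b)) :
    ∃ x₀, Tendsto x atTop (nhds x₀) := by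
  have hcd : Continuous fun B : Matrix ι ι ℂ => B.det := Continuous.matrix_det continuous_id
  have hca : Continuous fun B : Matrix ι ι ℂ => B.adjugate :=
    Continuous.matrix_adjugate continuous_id
  have hd : Tendsto (fun n => (M n).det) atTop (nhds M₀.det) := (hcd.tendsto M₀).comp hM
  have ha : Tendsto (fun n => (M n).adjugate) atTop (nhds M₀.adjugate) :=
    (hca.tendsto M₀).comp hM
  have hab : Tendsto (fun n => (M n).adjugate.mulVec ((M n).mulVec (x n))) atTop
      (nhds (M₀.adjugate.mulVec b)) :=
    tendsto_mulVec ha hb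
  refine ⟨M₀.det⁻¹ • M₀.adjugate.mulVec b, ((hd.inv₀ hdet).smul hab).congr' ?_⟩
  filter_upwards [hd.eventually_ne hdet] with n hn
  rw [Matrix.mulVec_mulVec, Matrix.adjugate_mul, Matrix.smul_mulVec, Matrix.one_mulVec, smul_smul,
    inv_mul_cancel₀ hn, one_smul]

/-- The order in `n` of the contribution of `n ^ |(W,σ)| κ_{(W,σ)}` to the normalized cumulant of
traces of powers along the cycles of `γ`. -/
def transferExponent {m : ℕ} (W : Setoid (Fin m)) (γ σ : Equiv.Perm (Fin m)) : ℤ :=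
  numCycles γ - 2 + numCycles (γ * σ⁻¹) - ppLen W σ

theorem transferExponent_nonpos {m : ℕ} (hm : 0 < m) {W : Setoid (Fin m)}
    {γ σ : Equiv.Perm (Fin m)} (hσ : permLePartition σ W) (hW : W ⊔ cycleSetoid γ = ⊤) :
    transferExponent W γ σ ≤ 0 := by
  have hle : cycleSetoid γ ≤ W ⊔ cycleSetoid (γ * σ⁻¹) := by
    rw [cycleSetoid_le_iff]
    intro i
    have h1 : (W ⊔ cycleSetoid (γ * σ⁻¹)) i (σ i) := Setoid.le_def.1 le_sup_left (hσ i)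
    have h2 : (W ⊔ cycleSetoid (γ * σ⁻¹)) (σ i) (γ i) :=
      Setoid.le_def.1 le_sup_right ((cycleSetoid_rel _ _ _).2 ⟨1, by simp⟩)
    exact Setoid.trans' _ h1 h2
  have htop : W ⊔ cycleSetoid (γ * σ⁻¹) = ⊤ :=
    top_le_iff.1 (hW ▸ sup_le le_sup_left hle)
  have h := numCycles_triangle (γ * σ⁻¹) σ W hσ
  rw [htop, inv_mul_cancel_right, numBlocks_top hm] at h
  unfold transferExponent ppLen
  push_cast at h
  linarith

theorem transferExponent_top_conj {m : ℕ} (γ σ s : Equiv.Perm (Fin m)) :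
    transferExponent ⊤ (s * γ * s⁻¹) (s * σ * s⁻¹) = transferExponent ⊤ γ σ := by
  have h : s * γ * s⁻¹ * (s * σ * s⁻¹)⁻¹ = s * (γ * σ⁻¹) * s⁻¹ := by group
  unfold transferExponent ppLen
  rw [h, numCycles_conj, numCycles_conj, numCycles_conj]

theorem permLePartition_top {m : ℕ} (σ : Equiv.Perm (Fin m)) : permLePartition σ ⊤ :=
  fun _ => trivial

theorem transferExponent_top_eq_zero {m : ℕ} (hm : 0 < m) {γ σ : Equiv.Perm (Fin m)}
    (h : transferExponent ⊤ γ σ = 0) : σ = γ ∨ numCycles σ < numCycles γ := by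
  by_cases hγ : γ * σ⁻¹ = 1
  · exact Or.inl (mul_inv_eq_one.1 hγ).symm
  · have := numCycles_lt hγ
    unfold transferExponent ppLen at h
    rw [numBlocks_top hm] at h
    right
    omega

theorem transferExponent_top_self {m : ℕ} (hm : 0 < m) (γ : Equiv.Perm (Fin m)) :
    transferExponent ⊤ γ γ = 0 := by
  unfold transferExponent ppLen
  rw [numBlocks_top hm, mul_inv_cancel, numCycles_one]
  push_cast
  ring

theorem det_transfer_ne_zero {m : ℕ} (hm : 0 < m) :
    (Matrix.of fun γ σ : Equiv.Perm (Fin m) =>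
      if transferExponent ⊤ γ σ = 0 then (1 : ℂ) else 0).det ≠ 0 := by
  set M : Matrix (Equiv.Perm (Fin m)) (Equiv.Perm (Fin m)) ℂ :=
    Matrix.of fun γ σ => if transferExponent ⊤ γ σ = 0 then 1 else 0 with hM
  have hb : M.BlockTriangular fun σ => OrderDual.toDual (numCycles σ) := by
    intro γ σ h
    refine if_neg fun h0 => ?_
    rcases transferExponent_top_eq_zero hm h0 with rfl | h0
    · exact lt_irrefl _ h
    · exact lt_asymm h0 (OrderDual.toDual_lt_toDual.1 h)
  rw [hb.det]
  refine Finset.prod_ne_zero_iff.2 fun a _ => ?_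
  have h1 : M.toSquareBlock (fun σ => OrderDual.toDual (numCycles σ)) a = 1 := by
    ext ⟨γ, hγ⟩ ⟨σ, hσ⟩
    rw [Matrix.toSquareBlock_def, Matrix.of_apply, Matrix.one_apply, hM, Matrix.of_apply]
    refine if_congr ⟨fun h0 => ?_, fun h0 => ?_⟩ rfl rfl
    · rcases transferExponent_top_eq_zero hm h0 with rfl | h0
      · rfl
      · exact absurd (OrderDual.toDual_inj.1 (hγ.trans hσ.symm)) h0.ne'
    · obtain rfl := Subtype.mk.inj h0
      exact transferExponent_top_self hm γ
  rw [h1, Matrix.det_one]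
  exact one_ne_zero

section Inversion

variable {A : ℕ → Type*} [∀ n, Ring (A n)] [∀ n, Algebra ℂ (A n)]
  {E : ∀ n, A n →ₗ[ℂ] ℂ} {k : ∀ n, ∀ {l : ℕ}, Setoid (Fin l) → (Fin l → A n) → ℂ}
  {X : ∀ n, Matrix (Fin n) (Fin n) (A n)} {m₀ m : ℕ}

theorem traces_eq_sum_transfer (hk : ∀ n, IsCumulant (E n) (@k n))
    (hX : ∀ n, UnitarilyInvariant (E n) (X n)) {l : ℕ} {p : Fin l → ℕ} (hp : ∀ j, 1 ≤ p j)
    {e : (Σₗ j, Fin (p j)) ≃o Fin m} {γ : Equiv.Perm (Fin m)} (hγ : IsBlockPerm e γ) {n : ℕ}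
    (h : m ≤ n) (h0 : n ≠ 0) :
    (n : ℂ) ^ (2 * (l : ℤ) - 2) * k n ⊤ (fun j => ncTrace (X n ^ p j))
      = ∑ W ∈ Finset.univ.filter (fun W : Setoid (Fin m) => W ⊔ cycleSetoid γ = ⊤),
        ∑ σ ∈ Finset.univ.filter (fun σ => permLePartition σ W),
          (n : ℂ) ^ transferExponent W γ σ *
            ((n : ℂ) ^ ppLen W σ * kappaSeq (fun n => @k n) X W σ n) := by
  have hn : (n : ℂ) ≠ 0 := Nat.cast_ne_zero.2 h0
  rw [(hk n).traces_eq_sum (hX n) h hp hγ, Finset.mul_sum, Finset.mul_sum]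
  refine Finset.sum_congr rfl fun W _ => ?_
  rw [Finset.mul_sum, Finset.mul_sum, Finset.sum_filter]
  refine Finset.sum_congr rfl fun σ _ => ?_
  split_ifs with hσ
  · rw [kappaSeq_of_le h, hγ.numCycles_eq hp, ← mul_assoc, ← mul_assoc, ← mul_assoc]
    congr 1
    rw [inv_pow, ← zpow_natCast, ← zpow_natCast, ← zpow_neg, ← zpow_add₀ hn, ← zpow_add₀ hn,
      ← zpow_add₀ hn]
    congr 1
    unfold transferExponent
    rw [hγ.numCycles_eq hp]
    ring
  · rw [(hk n).kappa_eq_zero (hX n) h W σ hσ]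
    simp

/-- The part of the normalized cumulant of traces along the cycles of `γ` which comes from
cumulants of full degree. -/
def topTransfer (k : ∀ n, ∀ {l : ℕ}, Setoid (Fin l) → (Fin l → A n) → ℂ)
    (X : ∀ n, Matrix (Fin n) (Fin n) (A n)) (γ : Equiv.Perm (Fin m)) (n : ℕ) : ℂ :=
  ∑ σ, (n : ℂ) ^ transferExponent ⊤ γ σ *
    ((n : ℂ) ^ ppLen ⊤ σ * kappaSeq (fun n => @k n) X ⊤ σ n)

theorem exists_tendsto_topTransfer_of_isBlockPerm (hk : ∀ n, IsCumulant (E n) (@k n))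
    (hX : ∀ n, UnitarilyInvariant (E n) (X n)) (hm : 0 < m)
    (hK : ∀ m' < m, ∀ (V : Setoid (Fin m')) (π : Equiv.Perm (Fin m')),
      permLePartition π V → ∃ K : ℂ,
        Tendsto (fun n : ℕ => (n : ℂ) ^ (ppLen V π) * kappaSeq (fun n => @k n) X V π n)
          atTop (nhds K))
    {l : ℕ} {p : Fin l → ℕ} (hp : ∀ j, 1 ≤ p j)
    {e : (Σₗ j, Fin (p j)) ≃o Fin m} {γ : Equiv.Perm (Fin m)} (hγ : IsBlockPerm e γ)
    (hM : ∃ M : ℂ, Tendsto (fun n : ℕ => (n : ℂ) ^ (2 * (l : ℤ) - 2) *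
      k n ⊤ (fun j => ncTrace (X n ^ p j))) atTop (nhds M)) :
    ∃ b, Tendsto (topTransfer (fun n => @k n) X γ) atTop (nhds b) := by
  obtain ⟨M, hM⟩ := hM
  set F : Finset (Setoid (Fin m)) :=
    Finset.univ.filter (fun W : Setoid (Fin m) => W ⊔ cycleSetoid γ = ⊤) with hF
  set T : Setoid (Fin m) → ℕ → ℂ := fun W n =>
    ∑ σ ∈ Finset.univ.filter (fun σ => permLePartition σ W),
      (n : ℂ) ^ transferExponent W γ σ *
        ((n : ℂ) ^ ppLen W σ * kappaSeq (fun n => @k n) X W σ n) with hT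
  have hconv : ∀ W ∈ F.erase ⊤, ∃ c, Tendsto (T W) atTop (nhds c) := by
    intro W hW
    have hW' := (Finset.mem_filter.1 (Finset.mem_of_mem_erase hW)).2
    have : ∀ σ, ∃ c, permLePartition σ W → Tendsto (fun n : ℕ =>
        (n : ℂ) ^ transferExponent W γ σ *
          ((n : ℂ) ^ ppLen W σ * kappaSeq (fun n => @k n) X W σ n)) atTop (nhds c) := by
      intro σ
      by_cases hσ : permLePartition σ W
      · obtain ⟨K, hK⟩ := exists_tendsto_of_ne_top hk hX hK (Finset.ne_of_mem_erase hW) hσ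
        exact ⟨_, fun _ =>
          (tendsto_natCast_zpow (transferExponent_nonpos hm hσ hW')).mul hK⟩
      · exact ⟨0, fun h => absurd h hσ⟩
    choose c hc using this
    exact ⟨_, tendsto_finsetSum _ fun σ hσ => hc σ (Finset.mem_filter.1 hσ).2⟩
  choose! c hc using hconv
  refine ⟨_, (hM.sub (tendsto_finsetSum _ hc)).congr' ?_⟩
  filter_upwards [eventually_ge_atTop m, eventually_ne_atTop 0] with n hn hn0
  have htop : (⊤ : Setoid (Fin m)) ∈ F := by simp [hF]
  rw [traces_eq_sum_transfer hk hX hp hγ hn hn0, sub_eq_iff_eq_add]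
  refine (Finset.add_sum_erase F (fun W => T W n) htop).symm.trans ?_
  congr 1
  simp only [hT, topTransfer]
  rw [Finset.filter_true_of_mem fun σ _ => permLePartition_top σ]

theorem tendsto_topTransfer_conj_sub (hk : ∀ n, IsCumulant (E n) (@k n))
    (hX : ∀ n, UnitarilyInvariant (E n) (X n))
    (hcomm : AsympVanishingComm (fun n => @k n) X m₀) (hm : 0 < m) (hm₀ : m ≤ m₀)
    (s γ : Equiv.Perm (Fin m)) :
    Tendsto (fun n => topTransfer (fun n => @k n) X (s * γ * s⁻¹) n
      - topTransfer (fun n => @k n) X γ n) atTop (nhds 0) := by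
  have hterm : ∀ σ, Tendsto (fun n : ℕ => (n : ℂ) ^ transferExponent ⊤ γ σ *
      ((n : ℂ) ^ ppLen ⊤ σ * (kappaSeq (fun n => @k n) X ⊤ (s * σ * s⁻¹) n
        - kappaSeq (fun n => @k n) X ⊤ σ n))) atTop (nhds 0) := by
    intro σ
    have h := (tendsto_natCast_zpow (transferExponent_nonpos hm (permLePartition_top σ)
      (top_sup_eq (cycleSetoid γ)))).mul
      (tendsto_conj_sub hk hX hcomm hm₀ s ⊤ σ (permLePartition_top σ))
    rw [mul_zero] at h
    exact h
  have hsum := tendsto_finsetSum Finset.univ fun σ _ => hterm σ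
  rw [Finset.sum_const_zero] at hsum
  refine hsum.congr fun n => ?_
  unfold topTransfer
  rw [← (MulAut.conj s).toEquiv.sum_comp fun σ => (n : ℂ) ^ transferExponent ⊤ (s * γ * s⁻¹) σ *
    ((n : ℂ) ^ ppLen ⊤ σ * kappaSeq (fun n => @k n) X ⊤ σ n), ← Finset.sum_sub_distrib]
  refine Finset.sum_congr rfl fun σ _ => ?_
  have hlen : ppLen ⊤ (s * σ * s⁻¹) = ppLen ⊤ σ := by
    unfold ppLen
    rw [numCycles_conj]
  change _ = (n : ℂ) ^ transferExponent ⊤ (s * γ * s⁻¹) (s * σ * s⁻¹) *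
    ((n : ℂ) ^ ppLen ⊤ (s * σ * s⁻¹) * kappaSeq (fun n => @k n) X ⊤ (s * σ * s⁻¹) n) - _
  rw [transferExponent_top_conj, hlen]
  ring

theorem exists_tendsto_top (hk : ∀ n, IsCumulant (E n) (@k n))
    (hX : ∀ n, UnitarilyInvariant (E n) (X n))
    (hcomm : AsympVanishingComm (fun n => @k n) X m₀) (hm : 0 < m) (hm₀ : m ≤ m₀)
    (hK : ∀ m' < m, ∀ (V : Setoid (Fin m')) (π : Equiv.Perm (Fin m')),
      permLePartition π V → ∃ K : ℂ,
        Tendsto (fun n : ℕ => (n : ℂ) ^ (ppLen V π) * kappaSeq (fun n => @k n) X V π n)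
          atTop (nhds K))
    (hM : ∀ (l : ℕ) (p : Fin l → ℕ), (∀ j, 1 ≤ p j) → ∑ j, p j ≤ m₀ → ∃ M : ℂ,
      Tendsto (fun n : ℕ => (n : ℂ) ^ (2 * (l : ℤ) - 2) *
        k n ⊤ (fun j => ncTrace (X n ^ p j))) atTop (nhds M))
    (π : Equiv.Perm (Fin m)) :
    ∃ K : ℂ, Tendsto (fun n : ℕ => (n : ℂ) ^ (ppLen ⊤ π) * kappaSeq (fun n => @k n) X ⊤ π n)
      atTop (nhds K) := by
  have hb : ∀ γ : Equiv.Perm (Fin m),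
      ∃ b, Tendsto (topTransfer (fun n => @k n) X γ) atTop (nhds b) := by
    intro γ
    obtain ⟨l, p, e, s, hp, hsum, hγ⟩ := exists_isBlockPerm_conj γ
    obtain ⟨b, hb⟩ := exists_tendsto_topTransfer_of_isBlockPerm hk hX hm hK hp hγ
      (hM l p hp (hsum.trans_le hm₀))
    refine ⟨_, (hb.sub (tendsto_topTransfer_conj_sub hk hX hcomm hm hm₀ s γ)).congr fun n => ?_⟩
    exact sub_sub_cancel _ _
  choose b hb using hb
  have hmat : Tendsto (fun n : ℕ => Matrix.of fun γ σ : Equiv.Perm (Fin m) =>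
      (n : ℂ) ^ transferExponent ⊤ γ σ) atTop (nhds (Matrix.of fun γ σ =>
        if transferExponent ⊤ γ σ = 0 then (1 : ℂ) else 0)) :=
    tendsto_pi_nhds.2 fun γ => tendsto_pi_nhds.2 fun σ => tendsto_natCast_zpow
      (transferExponent_nonpos hm (permLePartition_top σ) (top_sup_eq (cycleSetoid γ)))
  obtain ⟨x, hx⟩ := exists_tendsto_of_mulVec (x := fun n σ =>
      (n : ℂ) ^ (ppLen ⊤ σ) * kappaSeq (fun n => @k n) X ⊤ σ n) hmat
    (det_transfer_ne_zero hm) (tendsto_pi_nhds.2 hb)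
  exact ⟨_, tendsto_pi_nhds.1 hx π⟩

theorem exists_tendsto_of_permLePartition (hk : ∀ n, IsCumulant (E n) (@k n))
    (hX : ∀ n, UnitarilyInvariant (E n) (X n))
    (hcomm : AsympVanishingComm (fun n => @k n) X m₀) (hm₀ : m ≤ m₀)
    (hK : ∀ m' < m₀, ∀ (V : Setoid (Fin m')) (π : Equiv.Perm (Fin m')),
      permLePartition π V → ∃ K : ℂ,
        Tendsto (fun n : ℕ => (n : ℂ) ^ (ppLen V π) * kappaSeq (fun n => @k n) X V π n)
          atTop (nhds K))
    (hM : ∀ (l : ℕ) (p : Fin l → ℕ), (∀ j, 1 ≤ p j) → ∑ j, p j ≤ m₀ → ∃ M : ℂ,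
      Tendsto (fun n : ℕ => (n : ℂ) ^ (2 * (l : ℤ) - 2) *
        k n ⊤ (fun j => ncTrace (X n ^ p j))) atTop (nhds M))
    {V : Setoid (Fin m)} {π : Equiv.Perm (Fin m)} (hπ : permLePartition π V) :
    ∃ K : ℂ, Tendsto (fun n : ℕ => (n : ℂ) ^ (ppLen V π) * kappaSeq (fun n => @k n) X V π n)
      atTop (nhds K) := by
  have hK' : ∀ m' < m, ∀ (V : Setoid (Fin m')) (π : Equiv.Perm (Fin m')),
      permLePartition π V → ∃ K : ℂ,
        Tendsto (fun n : ℕ => (n : ℂ) ^ (ppLen V π) * kappaSeq (fun n => @k n) X V π n)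
          atTop (nhds K) := fun m' hm' => hK m' (hm'.trans_le hm₀)
  by_cases hV : V = ⊤
  · subst hV
    rcases Nat.eq_zero_or_pos m with rfl | hm
    · have hbl : ∀ V : Setoid (Fin 0), numBlocks V = 0 := fun V =>
        Nat.le_zero.1 (numBlocks_le V)
      refine ⟨1, tendsto_const_nhds.congr fun n => ?_⟩
      have hlen : ppLen (⊤ : Setoid (Fin 0)) π = 0 := by
        unfold ppLen numCycles
        rw [hbl, hbl]
        simp
      have hone := hk n 0 ⊤ fun t => X n (Fin.castLE n.zero_le t) (Fin.castLE n.zero_le (π t))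
      have hcl : Setoid.classes (⊤ : Setoid (Fin 0)) = ∅ :=
        Set.eq_empty_of_forall_notMem fun B ⟨x, _⟩ => x.elim0
      rw [Finset.filter_true_of_mem fun _ _ => le_top,
        Fintype.sum_eq_single ⊤ fun W hW => absurd (Setoid.ext fun x => x.elim0) hW,
        momentV, hcl] at hone
      rw [kappaSeq_of_le n.zero_le, hlen, zpow_zero, one_mul, kappa, hone]
      simp
    · exact exists_tendsto_top hk hX hcomm hm hm₀ hK' hM π
  · exact exists_tendsto_of_ne_top hk hX hK' hV hπ

end Inversion

open scoped ComplexOrder in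
/-- (Inductive step.) For a sequence of unitarily invariant random matrices with
noncommutative entries having asymptotically vanishing commutators up to degree `m₀`, if the
microscopic limits `K_{(V,π)}` exist for all partitioned permutations of `{1,…,m}` with `m < m₀`
and the macroscopic limits `M_{p₁,…,p_l}` exist for all `p₁+⋯+p_l ≤ m₀`, then the microscopic
limits exist for all partitioned permutations of `{1,…,m}` with `m ≤ m₀` and depend only on the
conjugacy class. -/
theorem inductive_step_microscopic_convergence
    {A : ℕ → Type*} [∀ n, Ring (A n)] [∀ n, Algebra ℂ (A n)] [∀ n, StarRing (A n)]
    (E : ∀ n, A n →ₗ[ℂ] ℂ) (hE1 : ∀ n, E n 1 = 1)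
    (hEpos : ∀ n (x : A n), x ≠ 0 → 0 < E n (star x * x))
    (k : ∀ n, ∀ {l : ℕ}, Setoid (Fin l) → (Fin l → A n) → ℂ)
    (hk : ∀ n, IsCumulant (⇑(E n)) (@k n))
    (X : ∀ n, Matrix (Fin n) (Fin n) (A n))
    (hX : ∀ n, UnitarilyInvariant (⇑(E n)) (X n))
    (m₀ : ℕ) (hcomm : AsympVanishingComm (fun n => @k n) X m₀)
    (hK : ∀ (m : ℕ), m < m₀ → ∀ (V : Setoid (Fin m)) (π : Equiv.Perm (Fin m)),
      permLePartition π V → ∃ K : ℂ,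
        Tendsto (fun n : ℕ => (n : ℂ) ^ (ppLen V π) * kappaSeq (fun n => @k n) X V π n)
          atTop (nhds K))
    (hM : ∀ (l : ℕ) (p : Fin l → ℕ), (∀ i, 1 ≤ p i) → psum p l ≤ m₀ → ∃ M : ℂ,
      Tendsto (fun n : ℕ => (n : ℂ) ^ (2 * (l : ℤ) - 2) *
          k n ⊤ (fun i : Fin l => ncTrace ((X n) ^ (p i)))) atTop (nhds M)) :
    ∃ K : ∀ m : ℕ, Setoid (Fin m) → Equiv.Perm (Fin m) → ℂ,
      (∀ (m : ℕ), m ≤ m₀ → ∀ (V : Setoid (Fin m)) (π : Equiv.Perm (Fin m)),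
        permLePartition π V →
        Tendsto (fun n : ℕ => (n : ℂ) ^ (ppLen V π) * kappaSeq (fun n => @k n) X V π n)
          atTop (nhds (K m V π)))
      ∧ (∀ (m : ℕ), m ≤ m₀ → ∀ (V : Setoid (Fin m)) (π : Equiv.Perm (Fin m))
          (W : Setoid (Fin m)) (σ : Equiv.Perm (Fin m)),
          permLePartition π V → permLePartition σ W → ppConj V π W σ →
          K m V π = K m W σ) := by
  have hM' : ∀ (l : ℕ) (p : Fin l → ℕ), (∀ j, 1 ≤ p j) → ∑ j, p j ≤ m₀ → ∃ M : ℂ,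
      Tendsto (fun n : ℕ => (n : ℂ) ^ (2 * (l : ℤ) - 2) *
        k n ⊤ (fun j => ncTrace (X n ^ p j))) atTop (nhds M) := fun l p hp hsum =>
    hM l p hp (by simpa [psum] using hsum)
  have hlim : ∀ (m : ℕ) (V : Setoid (Fin m)) (π : Equiv.Perm (Fin m)), ∃ K : ℂ,
      m ≤ m₀ → permLePartition π V →
        Tendsto (fun n : ℕ => (n : ℂ) ^ (ppLen V π) * kappaSeq (fun n => @k n) X V π n)
          atTop (nhds K) := by
    intro m V π
    by_cases h : m ≤ m₀ ∧ permLePartition π V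
    · obtain ⟨K, hK⟩ := exists_tendsto_of_permLePartition hk hX hcomm h.1 hK hM' h.2
      exact ⟨K, fun _ _ => hK⟩
    · exact ⟨0, fun h₁ h₂ => absurd ⟨h₁, h₂⟩ h⟩
  choose K hK using hlim
  refine ⟨K, fun m hm V π => hK m V π hm, ?_⟩
  rintro m hm V π W _ hπ hσ ⟨s, rfl, hW⟩
  obtain rfl : W = Setoid.comap s.symm V := Setoid.ext fun a b => hW a b
  have h := (hK m _ _ hm hσ).sub (hK m V π hm hπ)
  have h0 := tendsto_nhds_unique h ((tendsto_conj_sub hk hX hcomm hm s V π hπ).congr fun n => by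
    rw [ppLen_conj, mul_sub])
  exact (sub_eq_zero.1 h0).symm

end HOF
end
end

section
/- For every n ≥ 1 and every strictly decreasing integer vector l = (l₁ > ⋯ > l_n) ∈ ℤⁿ, one has Σ_{i=1}^n γ_i = 1, where γ_i = (1/n)∏_{j≠i}(1 − 1/(l_i − l_j)); equivalently, Σ_{i=1}^n ∏_{j≠i}(1 − 1/(l_i − l_j)) = n. -/
open scoped Classical BigOperators
open Filter

noncomputable section

namespace HOF

variable {A : Type*}

open Polynomial in
/-- For distinct nodes `v i` in a field, `∑ i, ∏ j ≠ i, (1 - 1 / (v i - v j))` is the number of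
nodes: it is the leading coefficient of `N(X) - N(X - 1)` with `N = ∏ i, (X - v i)`, computed by
Lagrange interpolation at the nodes. -/
theorem sum_prod_one_sub_inv_sub {F ι : Type*} [Field F] [DecidableEq ι] (s : Finset ι)
    (v : ι → F) (hv : Set.InjOn v s) :
    ∑ i ∈ s, ∏ j ∈ s.erase i, (1 - (v i - v j)⁻¹) = s.card := by
  rcases s.eq_empty_or_nonempty with rfl | hs
  · simp
  have hcard : 0 < s.card := hs.card_pos
  let P : F[X] := Lagrange.nodal s v - Lagrange.nodal s (fun i => v i + 1)
  have hdeg : P.degree < s.card := by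
    have h := degree_sub_lt_left (p := Lagrange.nodal s v)
      (q := Lagrange.nodal s (fun i => v i + 1))
      (by simp only [Lagrange.degree_nodal]) Lagrange.nodal_ne_zero
      (by rw [Lagrange.nodal_monic.leadingCoeff, Lagrange.nodal_monic.leadingCoeff])
    rwa [Lagrange.degree_nodal] at h
  have hcoeff : P.coeff (s.card - 1) = s.card := by
    simp only [P, coeff_sub, Lagrange.nodal_eq, prod_X_sub_C_coeff_card_pred s _ hcard,
      Finset.sum_add_distrib]
    simp
  rw [← hcoeff, Lagrange.coeff_eq_sum hv hdeg]
  refine Finset.sum_congr rfl fun i hi => ?_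
  have heval : P.eval (v i) = ∏ j ∈ s.erase i, (v i - v j - 1) := by
    simp only [P, eval_sub, Lagrange.eval_nodal_at_node hi, Lagrange.eval_nodal]
    rw [← Finset.mul_prod_erase s _ hi]
    simp [sub_add_eq_sub_sub]
  rw [heval, ← Finset.prod_div_distrib]
  refine Finset.prod_congr rfl fun j hj => ?_
  have hne : v i - v j ≠ 0 := sub_ne_zero.mpr fun h =>
    (Finset.ne_of_mem_erase hj) (hv (Finset.mem_of_mem_erase hj) hi h.symm)
  rw [sub_div, div_self hne, one_div]

/-- For a strictly decreasing integer vector `l = (l₁ > ⋯ > l_n)`, the weights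
`γ_i = (1/n)∏_{j≠i}(1 - 1/(l_i - l_j))` of the spectral measure sum up to `1`; equivalently,
`Σ_i ∏_{j≠i}(1 - 1/(l_i - l_j)) = n`. -/
theorem sum_of_gamma_weights_eq_one
    (n : ℕ) (hn : 1 ≤ n) (l : Fin n → ℤ) (hl : ∀ i j : Fin n, i < j → l j < l i) :
    (∑ i : Fin n, (n : ℝ)⁻¹ *
        ∏ j ∈ Finset.univ.erase i, (1 - ((l i : ℝ) - (l j : ℝ))⁻¹)) = 1
    ∧ (∑ i : Fin n, ∏ j ∈ Finset.univ.erase i, (1 - ((l i : ℝ) - (l j : ℝ))⁻¹)) = n := by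
  have hinj : Function.Injective fun i => (l i : ℝ) :=
    Int.cast_injective.comp (StrictAnti.injective fun i j h => hl i j h)
  have hsum : (∑ i : Fin n, ∏ j ∈ Finset.univ.erase i, (1 - ((l i : ℝ) - (l j : ℝ))⁻¹)) = n := by
    simpa only [Finset.card_fin] using
      sum_prod_one_sub_inv_sub Finset.univ (fun i => (l i : ℝ)) hinj.injOn
  refine ⟨?_, hsum⟩
  rw [← Finset.mul_sum, hsum, inv_mul_cancel₀]
  exact_mod_cast (Nat.one_le_iff_ne_zero.mp hn)

end HOF
end
end

section
/- Let n ≥ 1, let l₁,…,l_n be commuting indeterminates (or arbitrary complex numbers), let L = diag(l₁,…,l_n), and let J be the n×n strictly upper triangular matrix with J_{ij} = −1 for i < j and J_{ij} = 0 otherwise. Then for every k ≥ 1: Σ_{1≤i,j≤n} [(L+J)^k]_{ij} = Σ_{q≥1} (−1)^{q−1} Σ_{α₁,…,α_q ≥ 0, α₁+⋯+α_q = k−q+1} Σ_{1≤i₁<⋯<i_q≤n} l_{i₁}^{α₁} l_{i₂}^{α₂} ⋯ l_{i_q}^{α_q}. -/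
open scoped Classical BigOperators
open Filter

noncomputable section

namespace HOF

variable {A : Type*}

open PowerSeries in
/-- The generating function of `k ↦ ∑ α, ∏ t, x t ^ α t` (the complete homogeneous symmetric
polynomials in the `x t`). -/
theorem coeff_prod_mk_pow {R : Type*} [CommRing R] {q : ℕ} (x : Fin q → R) (m : ℕ) :
    coeff m (∏ t, PowerSeries.mk fun a => x t ^ a)
      = ∑ α ∈ Finset.Nat.antidiagonalTuple q m, ∏ t, x t ^ α t := by
  rw [coeff_prod]
  refine Finset.sum_bij (fun a _ => ⇑a) ?_ ?_ ?_ ?_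
  · intro a ha
    simpa [Finset.mem_finsuppAntidiag, Finset.Nat.mem_antidiagonalTuple] using ha
  · intro a _ b _ h
    exact DFunLike.coe_injective h
  · intro b hb
    refine ⟨Finsupp.equivFunOnFinite.symm b, ?_, rfl⟩
    simpa [Finset.mem_finsuppAntidiag, Finset.Nat.mem_antidiagonalTuple] using hb
  · intro a _
    simp

theorem sum_powersetCard_eq_sum_strictMono {R : Type*} [CommRing R] {n : ℕ} (q : ℕ)
    (g : Fin n → R) :
    ∑ s ∈ Finset.powersetCard q Finset.univ, ∏ i ∈ s, g i
      = ∑ f ∈ Finset.univ.filter (fun f : Fin q → Fin n => StrictMono f), ∏ t, g (f t) := by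
  symm
  refine Finset.sum_bij (fun f _ => Finset.univ.image f) ?_ ?_ ?_ ?_
  · intro f hf
    have hf : StrictMono f := by simpa using hf
    simp [Finset.mem_powersetCard, Finset.card_image_of_injective _ hf.injective]
  · intro f hf f' hf' h
    have hf : StrictMono f := by simpa using hf
    have hf' : StrictMono f' := by simpa using hf'
    refine (hf.range_inj hf').1 ?_
    simpa using congrArg (fun s : Finset (Fin n) => (s : Set (Fin n))) h
  · intro s hs
    have hs : s.card = q := by simpa [Finset.mem_powersetCard] using hs
    refine ⟨s.orderEmbOfFin hs, by simpa using (s.orderEmbOfFin hs).strictMono, ?_⟩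
    simp
  · intro f hf
    have hf : StrictMono f := by simpa using hf
    rw [Finset.prod_image hf.injective.injOn]

open PowerSeries in
theorem coeff_prod_one_sub_X_mul_mk_pow {R : Type*} [CommRing R] {n : ℕ} (l : Fin n → R) (k : ℕ) :
    -coeff (k + 1) (∏ i, (1 - X * PowerSeries.mk fun a => l i ^ a))
      = ∑ q ∈ Finset.Icc 1 (k + 1), (-1 : R) ^ (q - 1) *
          ∑ α ∈ Finset.Nat.antidiagonalTuple q (k + 1 - q),
            ∑ f ∈ Finset.univ.filter (fun f : Fin q → Fin n => StrictMono f),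
              ∏ t, l (f t) ^ α t := by
  have hterm (s : Finset (Fin n)) :
      coeff (k + 1) (∏ i ∈ s, (-(X * PowerSeries.mk fun a => l i ^ a)))
        = if s.card ≤ k + 1 then (-1 : R) ^ s.card *
            coeff (k + 1 - s.card) (∏ i ∈ s, PowerSeries.mk fun a => l i ^ a) else 0 := by
    rw [Finset.prod_neg, Finset.prod_mul_distrib, Finset.prod_const,
      show ((-1 : R⟦X⟧) ^ s.card) = C ((-1) ^ s.card) by simp, coeff_C_mul, coeff_X_pow_mul']
    split_ifs <;> simp
  have hsupp : ∀ s ∈ (Finset.univ : Finset (Finset (Fin n))), s ∉ Finset.univ.filter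
      (fun s : Finset (Fin n) => s.card ∈ Finset.Icc 1 (k + 1)) →
      coeff (k + 1) (∏ i ∈ s, (-(X * PowerSeries.mk fun a => l i ^ a))) = 0 := by
    intro s _ hs
    rcases s.eq_empty_or_nonempty with rfl | hne
    · simp [coeff_one]
    · rw [hterm, if_neg]
      exact fun h => hs (by simpa using ⟨hne, h⟩)
  simp_rw [sub_eq_add_neg (1 : R⟦X⟧)]
  rw [Finset.prod_one_add, map_sum, Finset.powerset_univ,
    ← Finset.sum_subset (Finset.filter_subset _ _) hsupp,
    ← Finset.sum_fiberwise_eq_sum_filter, ← Finset.sum_neg_distrib]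
  refine Finset.sum_congr rfl fun q hq => ?_
  obtain ⟨hq₁, hq₂⟩ := Finset.mem_Icc.1 hq
  have hcard : Finset.univ.filter (fun s : Finset (Fin n) => s.card = q)
      = Finset.powersetCard q Finset.univ := by
    ext s
    simp [Finset.mem_powersetCard]
  calc
    _ = -∑ s ∈ Finset.powersetCard q Finset.univ, (-1 : R) ^ q *
          coeff (k + 1 - q) (∏ i ∈ s, PowerSeries.mk fun a => l i ^ a) := by
        rw [hcard]
        refine congrArg _ (Finset.sum_congr rfl fun s hs => ?_)
        rw [hterm, (Finset.mem_powersetCard.1 hs).2, if_pos hq₂]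
    _ = _ := by
        rw [← Finset.mul_sum, ← map_sum, sum_powersetCard_eq_sum_strictMono, map_sum,
          Finset.sum_comm]
        simp_rw [coeff_prod_mk_pow]
        obtain ⟨p, rfl⟩ := Nat.exists_eq_add_of_le' hq₁
        rw [Nat.add_sub_cancel, pow_succ]
        ring

/-- The sum of a diagonal matrix and the strictly upper triangular matrix with entries `-1`. -/
def diagonalAddTriangular {R : Type*} [CommRing R] {n : ℕ} (l : Fin n → R) :
    Matrix (Fin n) (Fin n) R :=
  Matrix.diagonal l + Matrix.of fun i j => if i < j then -1 else 0

theorem diagonalAddTriangular_mulVec_succ {R : Type*} [CommRing R] {n : ℕ} (l : Fin (n + 1) → R)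
    (v : Fin (n + 1) → R) (i : Fin n) :
    (diagonalAddTriangular l).mulVec v i.succ
      = (diagonalAddTriangular (fun j => l j.succ)).mulVec (fun j => v j.succ) i := by
  simp [diagonalAddTriangular, Matrix.mulVec, dotProduct, Fin.sum_univ_succ, Matrix.diagonal_apply]

theorem diagonalAddTriangular_mulVec_zero {R : Type*} [CommRing R] {n : ℕ} (l : Fin (n + 1) → R)
    (v : Fin (n + 1) → R) :
    (diagonalAddTriangular l).mulVec v 0 = l 0 * v 0 - ∑ j : Fin n, v j.succ := by
  simp [diagonalAddTriangular, Matrix.mulVec, dotProduct, Fin.sum_univ_succ, sub_eq_add_neg,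
    Matrix.diagonal_apply, (Fin.succ_ne_zero _).symm]

/-- The row sums of the powers of `diagonalAddTriangular l`. -/
def rowSumPow {R : Type*} [CommRing R] {n : ℕ} (l : Fin n → R) (k : ℕ) : Fin n → R :=
  ((diagonalAddTriangular l) ^ k).mulVec 1

theorem rowSumPow_zero {R : Type*} [CommRing R] {n : ℕ} (l : Fin n → R) :
    rowSumPow l 0 = 1 := by
  simp [rowSumPow]

theorem rowSumPow_succ {R : Type*} [CommRing R] {n : ℕ} (l : Fin n → R) (k : ℕ) :
    rowSumPow l (k + 1) = (diagonalAddTriangular l).mulVec (rowSumPow l k) := by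
  rw [rowSumPow, rowSumPow, pow_succ', Matrix.mulVec_mulVec]

theorem rowSumPow_apply_succ {R : Type*} [CommRing R] {n : ℕ} (l : Fin (n + 1) → R) (k : ℕ)
    (i : Fin n) : rowSumPow l k i.succ = rowSumPow (fun j => l j.succ) k i := by
  induction k generalizing i with
  | zero => simp [rowSumPow_zero]
  | succ k ih =>
    rw [rowSumPow_succ, rowSumPow_succ, diagonalAddTriangular_mulVec_succ]
    simp_rw [ih]

theorem rowSumPow_succ_apply_zero {R : Type*} [CommRing R] {n : ℕ} (l : Fin (n + 1) → R) (k : ℕ) :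
    rowSumPow l (k + 1) 0 = l 0 * rowSumPow l k 0 - ∑ i, rowSumPow (fun j => l j.succ) k i := by
  simp_rw [rowSumPow_succ, diagonalAddTriangular_mulVec_zero, rowSumPow_apply_succ]

open PowerSeries in
theorem one_sub_C_mul_X_mul_mk_pow {R : Type*} [CommRing R] (x : R) :
    (1 - C x * X) * (PowerSeries.mk fun a => x ^ a) = 1 := by
  ext k
  cases k with
  | zero => simp [sub_mul, mul_assoc]
  | succ k => simp [sub_mul, mul_assoc, coeff_succ_X_mul, coeff_one, pow_succ']

open PowerSeries in
/-- The generating function of the sums of all entries of the powers of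
`diagonalAddTriangular l`. -/
theorem one_sub_X_mul_mk_sum_rowSumPow {R : Type*} [CommRing R] {n : ℕ} (l : Fin n → R) :
    1 - X * (PowerSeries.mk fun k => ∑ i, rowSumPow l k i)
      = ∏ i, (1 - X * PowerSeries.mk fun a => l i ^ a) := by
  induction n with
  | zero =>
    ext k
    cases k <;> simp [coeff_succ_X_mul]
  | succ n ih =>
    rw [Fin.prod_univ_succ, ← ih fun j => l j.succ]
    set S : R⟦X⟧ := PowerSeries.mk fun k => ∑ i, rowSumPow (fun j => l j.succ) k i with hS
    set v : R⟦X⟧ := PowerSeries.mk fun k => rowSumPow l k 0 with hv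
    have hsum : (PowerSeries.mk fun k => ∑ i, rowSumPow l k i) = v + S := by
      ext k
      simp [hS, hv, Fin.sum_univ_succ, rowSumPow_apply_succ]
    have hrec : (1 - C (l 0) * X) * v = 1 - X * S := by
      ext k
      cases k with
      | zero => simp [hv, sub_mul, mul_assoc, rowSumPow_zero]
      | succ k =>
        simp [hv, hS, sub_mul, mul_assoc, coeff_succ_X_mul, coeff_one, rowSumPow_succ_apply_zero]
    have hgeom := one_sub_C_mul_X_mul_mk_pow (l 0)
    rw [hsum]
    set G : R⟦X⟧ := PowerSeries.mk fun a => l 0 ^ a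
    linear_combination -X * G * hrec + X * v * hgeom

/-- Želobenko's expansion: for `L = diag(l₁,…,l_n)` and `J` the strictly upper
triangular matrix with entries `-1`, the sum of all entries of `(L+J)^k` equals
`Σ_q (-1)^{q-1} Σ_{α₁+⋯+α_q = k-q+1} Σ_{i₁<⋯<i_q} l_{i₁}^{α₁} ⋯ l_{i_q}^{α_q}`. -/
theorem sum_entries_pow_diagonal_add_triangular
    (n : ℕ) (l : Fin n → ℂ) (k : ℕ) (hk : 1 ≤ k) :
    (∑ i : Fin n, ∑ j : Fin n,
        ((Matrix.diagonal l
          + Matrix.of (fun i j : Fin n => if i < j then (-1 : ℂ) else 0)) ^ k) i j)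
      = ∑ q ∈ Finset.Icc 1 (k + 1), (-1 : ℂ) ^ (q - 1) *
          ∑ α ∈ Finset.Nat.antidiagonalTuple q (k + 1 - q),
            ∑ f ∈ Finset.univ.filter (fun f : Fin q → Fin n => StrictMono f),
              ∏ t : Fin q, l (f t) ^ α t := by
  rw [← coeff_prod_one_sub_X_mul_mk_pow, ← one_sub_X_mul_mk_sum_rowSumPow]
  simp [PowerSeries.coeff_succ_X_mul, PowerSeries.coeff_one, rowSumPow, diagonalAddTriangular,
    Matrix.mulVec, dotProduct]

end HOF
end
end
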